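/- arXiv:2510.18393 — 13 statements merged into one kernel-verified Lean document; each statement's English description precedes it below -/
import Mathlib

section
/- Let H be a finite digraph with two distinguished distinct vertices s and t. Let D be the digraph whose vertex set is V(H) together with three new vertices x1_a, x2_a, x3_a for every arc a of H, and whose arcs are: for every arc a = (u,v) of H the five arcs (u, x1_a), (x1_a, x2_a), (x2_a, x3_a), (x3_a, x1_a), (x3_a, v), together with the single additional arc (t, s). Then D admits a (1,1)-factor all of whose cycles are odd if and only if H contains a Hamiltonian (s,t)-path. -/
/-- Vertices of the auxiliary digraph `D`: the vertices of `H` together with three new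
vertices `x1_a, x2_a, x3_a` (encoded as `(a, 0)`, `(a, 1)`, `(a, 2)`) for every arc `a`
of `H`. Here `H` is given by its vertex type `V` and arc relation `A`. -/
abbrev DVert (V : Type*) (A : V → V → Prop) : Type _ :=
  V ⊕ ({a : V × V // A a.1 a.2} × Fin 3)

/-- Arcs of the auxiliary digraph `D`: for every arc `a = (u, v)` of `H` the five arcs
`(u, x1_a)`, `(x1_a, x2_a)`, `(x2_a, x3_a)`, `(x3_a, x1_a)`, `(x3_a, v)`,
together with the single additional arc `(t, s)`. -/
def DArc {V : Type*} (A : V → V → Prop) (s t : V) :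
    DVert V A → DVert V A → Prop := fun x y =>
  (∃ a : {a : V × V // A a.1 a.2}, x = Sum.inl a.1.1 ∧ y = Sum.inr (a, 0)) ∨
  (∃ a : {a : V × V // A a.1 a.2}, x = Sum.inr (a, 0) ∧ y = Sum.inr (a, 1)) ∨
  (∃ a : {a : V × V // A a.1 a.2}, x = Sum.inr (a, 1) ∧ y = Sum.inr (a, 2)) ∨
  (∃ a : {a : V × V // A a.1 a.2}, x = Sum.inr (a, 2) ∧ y = Sum.inr (a, 0)) ∨
  (∃ a : {a : V × V // A a.1 a.2}, x = Sum.inr (a, 2) ∧ y = Sum.inl a.1.2) ∨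
  (x = Sum.inl t ∧ y = Sum.inl s)

open Function

/-- The factor `σ` traverses the gadget of the arc `(v, w)` of `H` from `v` to `w`. -/
def Traverses {V : Type*} {A : V → V → Prop} (σ : DVert V A → DVert V A) (v w : V) : Prop :=
  ∃ h : A v w, σ (Sum.inl v) = Sum.inr (⟨(v, w), h⟩, 0) ∧
    σ (Sum.inr (⟨(v, w), h⟩, 2)) = Sum.inl w

section Factor

variable {V : Type*} {A : V → V → Prop} {s t : V} {σ : DVert V A → DVert V A}

theorem factor_apply_zero (hσ : ∀ x, DArc A s t x (σ x)) (a : {a : V × V // A a.1 a.2}) :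
    σ (Sum.inr (a, 0)) = Sum.inr (a, 1) := by
  have := hσ (Sum.inr (a, 0))
  simp only [DArc, Sum.inr.injEq, Prod.mk.injEq, reduceCtorEq, false_and, exists_false,
    false_or, or_false] at this
  simpa using this

theorem factor_apply_one (hσ : ∀ x, DArc A s t x (σ x)) (a : {a : V × V // A a.1 a.2}) :
    σ (Sum.inr (a, 1)) = Sum.inr (a, 2) := by
  have := hσ (Sum.inr (a, 1))
  simp only [DArc, Sum.inr.injEq, Prod.mk.injEq, reduceCtorEq, false_and, exists_false,
    false_or, or_false] at this
  simpa using this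

theorem factor_apply_two (hσ : ∀ x, DArc A s t x (σ x)) (a : {a : V × V // A a.1 a.2}) :
    σ (Sum.inr (a, 2)) = Sum.inr (a, 0) ∨ σ (Sum.inr (a, 2)) = Sum.inl a.1.2 := by
  rcases hσ (Sum.inr (a, 2)) with ⟨b, h, h'⟩ | ⟨b, h, h'⟩ | ⟨b, h, h'⟩ | ⟨b, h, h'⟩ |
    ⟨b, h, h'⟩ | ⟨h, h'⟩ <;> simp_all

theorem factor_apply_inl (hσ : ∀ x, DArc A s t x (σ x)) (v : V) :
    (v = t ∧ σ (Sum.inl v) = Sum.inl s) ∨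
      ∃ w, ∃ h : A v w, σ (Sum.inl v) = Sum.inr (⟨(v, w), h⟩, 0) := by
  rcases hσ (Sum.inl v) with ⟨⟨⟨u, w⟩, hb⟩, h, h'⟩ | ⟨b, h, h'⟩ | ⟨b, h, h'⟩ | ⟨b, h, h'⟩ |
    ⟨b, h, h'⟩ | ⟨h, h'⟩
  · obtain rfl : v = u := by simpa using h
    exact Or.inr ⟨w, hb, h'⟩
  all_goals simp_all

/-- In an injective factor, each vertex of `H` either uses the arc `(t, s)` or traverses a
gadget completely. -/
theorem factor_step (hσ : ∀ x, DArc A s t x (σ x)) (hinj : Injective σ) (v : V) :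
    ∃ w, (v = t ∧ w = s ∧ σ (Sum.inl v) = Sum.inl s) ∨ Traverses σ v w := by
  rcases factor_apply_inl hσ v with ⟨h, h'⟩ | ⟨w, h, h'⟩
  · exact ⟨s, Or.inl ⟨h, rfl, h'⟩⟩
  · refine ⟨w, Or.inr ⟨h, h', ?_⟩⟩
    refine (factor_apply_two hσ ⟨(v, w), h⟩).resolve_left fun h2 => ?_
    have := hinj (h'.trans h2.symm)
    simp at this

theorem Traverses.iterate_three (hσ : ∀ x, DArc A s t x (σ x)) {v w : V}
    (h : Traverses σ v w) : ∃ a, σ^[3] (Sum.inl v) = Sum.inr (a, 2) := by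
  obtain ⟨h, h1, h2⟩ := h
  refine ⟨⟨(v, w), h⟩, ?_⟩
  simp [iterate_succ_apply, h1, factor_apply_zero hσ, factor_apply_one hσ]

theorem Traverses.iterate_four (hσ : ∀ x, DArc A s t x (σ x)) {v w : V}
    (h : Traverses σ v w) : σ^[4] (Sum.inl v) = Sum.inl w := by
  obtain ⟨h, h1, h2⟩ := h
  simp [iterate_succ_apply, h1, h2, factor_apply_zero hσ, factor_apply_one hσ]

theorem iterate_four_mul (hσ : ∀ x, DArc A s t x (σ x)) {g : V → V} {v : V} {n : ℕ}
    (h : ∀ i < n, Traverses σ (g^[i] v) (g^[i + 1] v)) :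
    σ^[4 * n] (Sum.inl v) = Sum.inl (g^[n] v) := by
  induction n with
  | zero => rfl
  | succ n ih =>
    rw [Nat.mul_succ, Nat.add_comm, iterate_add_apply, ih fun i hi => h i (by omega),
      (h n (by omega)).iterate_four hσ]

/-- A cycle that meets `H` and never uses the arc `(t, s)` has length divisible by four. -/
theorem not_odd_minimalPeriod (hσ : ∀ x, DArc A s t x (σ x)) {g : V → V} {v : V}
    (h : ∀ i, Traverses σ (g^[i] v) (g^[i + 1] v)) :
    ¬ Odd (minimalPeriod σ (Sum.inl v)) := by
  intro hodd
  have hper := iterate_minimalPeriod (f := σ) (x := Sum.inl v)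
  set n := minimalPeriod σ (Sum.inl v)
  have hn : n = n % 4 + 4 * (n / 4) := (Nat.mod_add_div n 4).symm
  rw [hn, iterate_add_apply, iterate_four_mul hσ fun i _ => h i] at hper
  obtain ⟨k, hk⟩ := hodd
  have hr : n % 4 = 1 ∨ n % 4 = 3 := by omega
  rcases hr with hr | hr
  · obtain ⟨_, h1, _⟩ := h (n / 4)
    rw [hr, iterate_one, h1] at hper
    simp at hper
  · obtain ⟨a, h1⟩ := (h (n / 4)).iterate_three hσ
    rw [hr, h1] at hper
    simp at hper

theorem exists_hamiltonian_path_of_factor [Fintype V] (hσ : ∀ x, DArc A s t x (σ x))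
    (hinj : Injective σ) (hodd : ∀ x, Odd (minimalPeriod σ x)) :
    ∃ (m : ℕ) (f : Fin (m + 1) → V), Bijective f ∧ f 0 = s ∧ f (Fin.last m) = t ∧
      ∀ i : Fin m, A (f i.castSucc) (f i.succ) := by
  choose g hg using factor_step hσ hinj
  have hreach (v : V) : ∃ i, g^[i] v = t ∧ σ (Sum.inl t) = Sum.inl s := by
    by_contra! hne
    refine not_odd_minimalPeriod hσ (g := g) (v := v) (fun i => ?_) (hodd _)
    rw [iterate_succ_apply']
    refine (hg _).resolve_left fun ⟨h, _, h'⟩ => hne i h (h ▸ h')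
  obtain ⟨_, -, hts⟩ := hreach t
  have hgt : g t = s := by
    rcases hg t with ⟨_, h, _⟩ | ⟨_, h, _⟩
    · exact h
    · simp [hts] at h
  have htrav {v : V} (hv : v ≠ t) : Traverses σ v (g v) :=
    (hg v).resolve_left fun h => hv h.1
  have hne {v : V} (hv : v ≠ t) : g v ≠ s := fun h => by
    have h4 := (htrav hv).iterate_four hσ
    obtain ⟨a, h3⟩ := (htrav hv).iterate_three hσ
    rw [iterate_succ_apply', h3, h, ← hts] at h4
    simpa using hinj h4
  have ginj : Injective g := by
    intro v w hvw
    by_cases hv : v = t <;> by_cases hw : w = t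
    · rw [hv, hw]
    · exact absurd (hvw ▸ hv ▸ hgt) (hne hw)
    · exact absurd (hvw.trans (hw ▸ hgt)) (hne hv)
    · have h1 := (htrav hv).iterate_four hσ
      rw [hvw, ← (htrav hw).iterate_four hσ] at h1
      simpa using hinj.iterate 4 h1
  let p : Equiv.Perm V := Equiv.ofBijective g (Finite.injective_iff_bijective.1 ginj)
  have hp (v : V) : p v = g v := rfl
  have hsame (v : V) : p.SameCycle v t := by
    obtain ⟨i, hi, -⟩ := hreach v
    refine ⟨i, ?_⟩
    rw [zpow_natCast, ← Equiv.Perm.iterate_eq_pow]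
    exact hi
  have hcyc : p.IsCycleOn ((Finset.univ : Finset V) : Set V) :=
    ⟨by simp, fun x _ y _ => (hsame x).trans (hsame y).symm⟩
  obtain ⟨m, hm⟩ : ∃ m, Fintype.card V = m + 1 :=
    Nat.exists_eq_succ_of_ne_zero (Fintype.card_pos_iff.2 ⟨t⟩).ne'
  have hlast : (p ^ m) s = t := by
    have := hcyc.pow_card_apply (Finset.mem_univ t)
    rwa [Finset.card_univ, hm, pow_succ, Equiv.Perm.mul_apply, hp, hgt] at this
  have hsurj : Surjective fun i : Fin (m + 1) => (p ^ (i : ℕ)) s := fun v => by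
    obtain ⟨n, hn, h⟩ := hcyc.exists_pow_eq (Finset.mem_univ s) (Finset.mem_univ v)
    exact ⟨⟨n, by rwa [Finset.card_univ, hm] at hn⟩, h⟩
  have hbij := (Fintype.bijective_iff_surjective_and_card _).2 ⟨hsurj, by simp [hm]⟩
  refine ⟨m, _, hbij, rfl, hlast, fun i => ?_⟩
  have hi : (p ^ (i : ℕ)) s ≠ t := fun h =>
    (Fin.castSucc_lt_last i).ne (hbij.1 (h.trans hlast.symm))
  obtain ⟨h, -⟩ := htrav hi
  simpa [pow_succ', hp] using h

open Classical in
/-- The factor of `D` which traverses the gadgets of the arcs `(v, g v)` with `v ≠ t`, uses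
the arc `(t, s)`, and covers every other gadget by a triangle. -/
noncomputable def pathFactor (A : V → V → Prop) (s t : V) (g : V → V)
    (hg : ∀ v, v ≠ t → A v (g v)) : DVert V A → DVert V A
  | Sum.inl v => if h : v = t then Sum.inl s else Sum.inr (⟨(v, g v), hg v h⟩, 0)
  | Sum.inr (a, 0) => Sum.inr (a, 1)
  | Sum.inr (a, 1) => Sum.inr (a, 2)
  | Sum.inr (a, 2) => if a.1.1 ≠ t ∧ a.1.2 = g a.1.1 then Sum.inl a.1.2 else Sum.inr (a, 0)

variable {g : V → V} (hg : ∀ v, v ≠ t → A v (g v))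

theorem dArc_pathFactor (x : DVert V A) : DArc A s t x (pathFactor A s t g hg x) := by
  rcases x with v | ⟨a, i⟩
  · by_cases h : v = t
    · simp [pathFactor, DArc, h]
    · exact Or.inl ⟨⟨(v, g v), hg v h⟩, by simp [pathFactor, h]⟩
  · fin_cases i
    · simp [pathFactor, DArc]
    · simp [pathFactor, DArc]
    · by_cases h : a.1.1 ≠ t ∧ a.1.2 = g a.1.1
      · exact Or.inr <| Or.inr <| Or.inr <| Or.inr <| Or.inl ⟨a, by simp [pathFactor, h]⟩
      · exact Or.inr <| Or.inr <| Or.inr <| Or.inl ⟨a, by simp only [pathFactor, if_neg h]; simp⟩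

theorem traverses_pathFactor {v : V} (hv : v ≠ t) :
    Traverses (pathFactor A s t g hg) v (g v) :=
  ⟨hg v hv, by simp [pathFactor, hv], by simp [pathFactor, hv]⟩

theorem surjective_pathFactor (hgs : Surjective g) (hgt : g t = s) :
    Surjective (pathFactor A s t g hg) := by
  rintro (v | ⟨a, i⟩)
  · obtain ⟨u, rfl⟩ := hgs v
    by_cases hu : u = t
    · exact ⟨Sum.inl t, by simp [pathFactor, hu, hgt]⟩
    · exact ⟨_, (traverses_pathFactor hg hu).choose_spec.2⟩
  · fin_cases i
    · by_cases h : a.1.1 ≠ t ∧ a.1.2 = g a.1.1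
      · refine ⟨Sum.inl a.1.1, ?_⟩
        obtain ⟨⟨u, w⟩, ha⟩ := a
        obtain ⟨h1, rfl : w = g u⟩ := h
        simp [pathFactor, h1]
      · exact ⟨Sum.inr (a, 2), by simp only [pathFactor, if_neg h]; simp⟩
    · exact ⟨Sum.inr (a, 0), rfl⟩
    · exact ⟨Sum.inr (a, 1), rfl⟩

theorem odd_minimalPeriod_pathFactor {m : ℕ} (hlast : g^[m] s = t)
    (hlt : ∀ i < m, g^[i] s ≠ t) (hall : ∀ v, ∃ i ≤ m, g^[i] s = v) (x : DVert V A) :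
    Odd (minimalPeriod (pathFactor A s t g hg) x) := by
  set σ := pathFactor A s t g hg with hσ_def
  have hσ : ∀ x, DArc A s t x (σ x) := dArc_pathFactor hg
  suffices h : ∃ n, Odd n ∧ IsPeriodicPt σ n x by
    obtain ⟨n, hn, hx⟩ := h
    exact hn.of_dvd_nat hx.minimalPeriod_dvd
  have hiter {n : ℕ} (hn : n ≤ m) : σ^[4 * n] (Sum.inl s) = Sum.inl (g^[n] s) :=
    iterate_four_mul hσ fun i hi => by
      rw [iterate_succ_apply']
      exact traverses_pathFactor hg (hlt i (by omega))
  have hs : IsPeriodicPt σ (4 * m + 1) (Sum.inl s) := by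
    rw [IsPeriodicPt, IsFixedPt, iterate_succ_apply', hiter le_rfl, hlast]
    simp [hσ_def, pathFactor]
  have hinl (v : V) : IsPeriodicPt σ (4 * m + 1) (Sum.inl v) := by
    obtain ⟨i, hi, rfl⟩ := hall v
    rw [← hiter hi]
    exact hs.apply_iterate _
  have hm : Odd (4 * m + 1) := ⟨2 * m, by ring⟩
  rcases x with v | ⟨a, i⟩
  · exact ⟨_, hm, hinl v⟩
  · have h0 := factor_apply_zero hσ a
    have h1 := factor_apply_one hσ a
    suffices h : ∃ n, Odd n ∧ IsPeriodicPt σ n (Sum.inr (a, 0)) by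
      obtain ⟨n, hn, hx⟩ := h
      refine ⟨n, hn, ?_⟩
      fin_cases i
      · exact hx
      · simpa [h0] using hx.apply_iterate 1
      · simpa [h0, h1] using hx.apply_iterate 2
    by_cases h : a.1.1 ≠ t ∧ a.1.2 = g a.1.1
    · obtain ⟨⟨u, w⟩, ha⟩ := a
      obtain ⟨hu, rfl : w = g u⟩ := h
      obtain ⟨_, h2, -⟩ := traverses_pathFactor (s := s) hg hu
      refine ⟨_, hm, ?_⟩
      simpa [hσ_def, h2] using (hinl u).apply_iterate 1
    · have h2 : σ (Sum.inr (a, 2)) = Sum.inr (a, 0) := by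
        simp only [hσ_def, pathFactor, if_neg h]
      refine ⟨3, by decide, ?_⟩
      simp [IsPeriodicPt, IsFixedPt, iterate_succ_apply, h0, h1, h2]

theorem exists_factor_of_hamiltonian_path [Finite V] {m : ℕ} {f : Fin (m + 1) → V}
    (hf : Bijective f) (h0 : f 0 = s) (hm : f (Fin.last m) = t)
    (hA : ∀ i : Fin m, A (f i.castSucc) (f i.succ)) :
    ∃ σ : Equiv.Perm (DVert V A), (∀ x, DArc A s t x (σ x)) ∧
      ∀ x, Odd (minimalPeriod σ x) := by
  let e := Equiv.ofBijective f hf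
  let g : V → V := fun v => f (finRotate _ (e.symm v))
  have hgf (i : Fin (m + 1)) : g (f i) = f (finRotate _ i) := by
    have : e.symm (f i) = i := e.symm_apply_apply i
    simp only [g, this]
  have hgf_succ (i : Fin m) : g (f i.castSucc) = f i.succ := by
    rw [hgf, finRotate_apply, Fin.coeSucc_eq_succ]
  have hg : ∀ v, v ≠ t → A v (g v) := by
    intro v hv
    obtain ⟨i, rfl⟩ := hf.2 v
    obtain ⟨j, rfl⟩ := Fin.exists_castSucc_eq.2 fun h : i = Fin.last m => hv (h ▸ hm)
    rw [hgf_succ]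
    exact hA j
  have hgt : g t = s := by rw [← hm, hgf, finRotate_last, h0]
  have hgs : Surjective g := hf.2.comp ((finRotate _).surjective.comp e.symm.surjective)
  have hiter (i : Fin (m + 1)) : g^[i] s = f i := by
    induction i using Fin.induction with
    | zero => exact h0.symm
    | succ i ih => rw [Fin.val_succ, iterate_succ_apply', ← hgf_succ, ← ih, Fin.val_castSucc]
  refine ⟨Equiv.ofBijective _
    (Finite.surjective_iff_bijective.1 (surjective_pathFactor hg hgs hgt)), dArc_pathFactor hg,
    odd_minimalPeriod_pathFactor (m := m) hg ?_ ?_ ?_⟩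
  · simpa [hm] using hiter (Fin.last m)
  · intro i hi h
    have h' := hiter (Fin.castSucc ⟨i, hi⟩)
    exact (Fin.castSucc_lt_last ⟨i, hi⟩).ne (hf.1 (h'.symm.trans (h.trans hm.symm)))
  · intro v
    obtain ⟨i, rfl⟩ := hf.2 v
    exact ⟨i, Fin.is_le i, hiter i⟩

end Factor

/-- `D` admits a `(1,1)`-factor all of whose cycles are odd iff `H` contains a
Hamiltonian `(s, t)`-path. -/
theorem allOdd_factor_iff_hamiltonian_path
    {V : Type*} [Fintype V] (A : V → V → Prop) (hA : Irreflexive A)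
    (s t : V) (hst : s ≠ t) :
    (∃ σ : Equiv.Perm (DVert V A),
        (∀ x, DArc A s t x (σ x)) ∧
        ∀ x, Odd (Function.minimalPeriod (⇑σ) x)) ↔
    (∃ (m : ℕ) (f : Fin (m + 1) → V),
        Function.Bijective f ∧ f 0 = s ∧ f (Fin.last m) = t ∧
        ∀ i : Fin m, A (f i.castSucc) (f i.succ)) := by
  exact ⟨fun ⟨σ, hσ, hodd⟩ => exists_hamiltonian_path_of_factor hσ σ.injective hodd,
    fun ⟨_, _, hf, h0, hm, h⟩ => exists_factor_of_hamiltonian_path hf h0 hm h⟩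
end

section
/- Let H be a finite digraph with distinguished distinct vertices s and t, and let D be the digraph whose vertex set is V(H) together with three new vertices x1_a, x2_a, x3_a for every arc a of H, and whose arcs are: for every arc a = (u,v) of H the five arcs S_a = {(u, x1_a), (x1_a, x2_a), (x2_a, x3_a), (x3_a, x1_a), (x3_a, v)}, together with the arc (t, s). Then for every (1,1)-factor σ of D and every arc a = (u,v) of H, one has σ(x1_a) = x2_a and σ(x2_a) = x3_a, and exactly one of the following holds: (i) σ(u) = x1_a and σ(x3_a) = v, or (ii) σ(x3_a) = x1_a. -/
/-- For every `(1,1)`-factor `σ` of `D` and every arc `a = (u, v)` of `H`: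
`σ(x1_a) = x2_a`, `σ(x2_a) = x3_a`, and exactly one of the following holds:
(i) `σ(u) = x1_a` and `σ(x3_a) = v`, or (ii) `σ(x3_a) = x1_a`. -/
theorem factor_arc_gadget_dichotomy
    {V : Type*} [Fintype V] (A : V → V → Prop) (hA : Irreflexive A)
    (s t : V) (hst : s ≠ t)
    (σ : Equiv.Perm (DVert V A)) (hσ : ∀ x, DArc A s t x (σ x)) :
    ∀ a : {a : V × V // A a.1 a.2},
      σ (Sum.inr (a, 0)) = Sum.inr (a, 1) ∧
      σ (Sum.inr (a, 1)) = Sum.inr (a, 2) ∧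
      Xor'
        (σ (Sum.inl a.1.1) = Sum.inr (a, 0) ∧ σ (Sum.inr (a, 2)) = Sum.inl a.1.2)
        (σ (Sum.inr (a, 2)) = Sum.inr (a, 0)) := by
  intro a
  have h0 : σ (Sum.inr (a, 0)) = Sum.inr (a, 1) := by
    simpa [DArc] using hσ (Sum.inr (a, 0))
  have h1 : σ (Sum.inr (a, 1)) = Sum.inr (a, 2) := by
    simpa [DArc] using hσ (Sum.inr (a, 1))
  have h2 : σ (Sum.inr (a, 2)) = Sum.inr (a, 0) ∨ σ (Sum.inr (a, 2)) = Sum.inl a.1.2 := by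
    rcases hσ (Sum.inr (a, 2)) with
      ⟨b, hx, _⟩ | ⟨b, hx, _⟩ | ⟨b, hx, _⟩ | ⟨b, hx, hy⟩ | ⟨b, hx, hy⟩ | ⟨hx, _⟩ <;>
      simp_all
  have h_pre : σ (Sum.inl a.1.1) = Sum.inr (a, 0) ∨ σ (Sum.inr (a, 2)) = Sum.inr (a, 0) := by
    obtain ⟨y, hy⟩ := σ.surjective (Sum.inr (a, 0))
    have h := hσ y
    rw [hy] at h
    rcases h with
      ⟨b, hx, h⟩ | ⟨b, hx, h⟩ | ⟨b, hx, h⟩ | ⟨b, hx, h⟩ | ⟨b, hx, h⟩ | ⟨hx, h⟩ <;>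
      simp_all
  refine ⟨h0, h1, ?_⟩
  rcases h2 with h2 | h2
  · exact Or.inr ⟨h2, fun h => by simp [h2] at h⟩
  · exact Or.inl ⟨⟨h_pre.resolve_right (by simp [h2]), h2⟩, by simp [h2]⟩
end

section
/- Let H be a finite digraph with distinguished distinct vertices s and t, and let D be the digraph whose vertex set is V(H) together with three new vertices x1_a, x2_a, x3_a for every arc a of H, and whose arcs are: for every arc a = (u,v) of H the five arcs (u, x1_a), (x1_a, x2_a), (x2_a, x3_a), (x3_a, x1_a), (x3_a, v), together with the arc (t, s). Let σ be a (1,1)-factor of D all of whose cycles are odd. Then every cycle of σ that contains a vertex of V(H) contains the arc (t, s); consequently there is exactly one such cycle and it contains all vertices of V(H). -/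
/-- A `(1,1)`-factor leaving an original vertex other than by the arc `(t, s)` traverses the
three new vertices of one arc of `H` and then returns to an original vertex. -/
theorem exists_gadget_path {V : Type*} {A : V → V → Prop} {s t : V}
    {σ : Equiv.Perm (DVert V A)} (hσ : ∀ x, DArc A s t x (σ x)) {v : V}
    (hv : ¬ (v = t ∧ σ (Sum.inl v) = Sum.inl s)) :
    ∃ a : {a : V × V // A a.1 a.2}, σ (Sum.inl v) = Sum.inr (a, 0) ∧
      σ (Sum.inr (a, 0)) = Sum.inr (a, 1) ∧ σ (Sum.inr (a, 1)) = Sum.inr (a, 2) ∧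
      σ (Sum.inr (a, 2)) = Sum.inl a.1.2 := by
  obtain ⟨a, h0⟩ : ∃ a, σ (Sum.inl v) = Sum.inr (a, 0) := by
    have h := hσ (Sum.inl v)
    simp only [DArc, Sum.inl.injEq, reduceCtorEq, false_and, exists_false, false_or] at h
    rcases h with ⟨a, -, h⟩ | h
    · exact ⟨a, h⟩
    · exact absurd h hv
  have h1 : σ (Sum.inr (a, 0)) = Sum.inr (a, 1) := by
    simpa [DArc, -Subtype.exists] using hσ (Sum.inr (a, 0))
  have h2 : σ (Sum.inr (a, 1)) = Sum.inr (a, 2) := by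
    simpa [DArc, -Subtype.exists] using hσ (Sum.inr (a, 1))
  have h3 : σ (Sum.inr (a, 2)) = Sum.inr (a, 0) ∨ σ (Sum.inr (a, 2)) = Sum.inl a.1.2 := by
    simpa [DArc, -Subtype.exists] using hσ (Sum.inr (a, 2))
  refine ⟨a, h0, h1, h2, h3.resolve_left fun h => ?_⟩
  exact Sum.inr_ne_inl (σ.injective (h.trans h0.symm))

/-- An odd cycle of a `(1,1)`-factor through an original vertex contains the arc `(t, s)`. -/
theorem sameCycle_and_apply_eq_of_odd_minimalPeriod {V : Type*} {A : V → V → Prop} {s t : V}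
    {σ : Equiv.Perm (DVert V A)} (hσ : ∀ x, DArc A s t x (σ x)) (u : V)
    (hodd : Odd (Function.minimalPeriod (⇑σ) (Sum.inl u))) :
    σ.SameCycle (Sum.inl u) (Sum.inl t) ∧ σ (Sum.inl t) = Sum.inl s := by
  by_contra hcon
  have path : ∀ n v, σ^[n] (Sum.inl u) = Sum.inl v →
      ∃ a : {a : V × V // A a.1 a.2}, σ^[n + 1] (Sum.inl u) = Sum.inr (a, 0) ∧
        σ^[n + 3] (Sum.inl u) = Sum.inr (a, 2) ∧ σ^[n + 4] (Sum.inl u) = Sum.inl a.1.2 := by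
    intro n v hn
    obtain ⟨a, h0, h1, h2, h3⟩ := exists_gadget_path hσ (v := v) fun ⟨hvt, hs⟩ => by
      subst hvt
      exact hcon ⟨⟨n, by rw [zpow_natCast, ← Equiv.Perm.iterate_eq_pow, hn]⟩, hs⟩
    refine ⟨a, ?_, ?_, ?_⟩ <;> simp only [Function.iterate_succ_apply', hn, h0, h1, h2, h3]
  have orig : ∀ q, ∃ v, σ^[4 * q] (Sum.inl u) = Sum.inl v := by
    intro q
    induction q with
    | zero => exact ⟨u, rfl⟩
    | succ q ih =>
      obtain ⟨v, hv⟩ := ih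
      obtain ⟨a, -, -, h⟩ := path _ v hv
      exact ⟨_, h⟩
  have hper := Function.iterate_minimalPeriod (f := σ) (x := Sum.inl u)
  generalize Function.minimalPeriod (⇑σ) (Sum.inl u) = p at hodd hper
  obtain ⟨v, hv⟩ := orig (p / 4)
  obtain ⟨a, h1, h3, -⟩ := path _ v hv
  obtain ⟨k, hk⟩ := hodd
  obtain hp | hp : p = 4 * (p / 4) + 1 ∨ p = 4 * (p / 4) + 3 := by omega
  · rw [← hp, hper] at h1
    exact Sum.inl_ne_inr h1
  · rw [← hp, hper] at h3
    exact Sum.inl_ne_inr h3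

/-- If `σ` is a `(1,1)`-factor of `D` all of whose cycles are odd, then every cycle of
`σ` containing a vertex of `V(H)` contains the arc `(t, s)`: the cycle of any original
vertex `u` passes through `t`, and `σ(t) = s`.  Consequently there is exactly one such
cycle and it contains all vertices of `V(H)`. -/
theorem allOdd_factor_original_vertices_one_cycle
    {V : Type*} [Fintype V] (A : V → V → Prop) (hA : Irreflexive A)
    (s t : V) (hst : s ≠ t)
    (σ : Equiv.Perm (DVert V A)) (hσ : ∀ x, DArc A s t x (σ x))
    (hodd : ∀ x, Odd (Function.minimalPeriod (⇑σ) x)) :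
    σ (Sum.inl t) = Sum.inl s ∧
    ∀ u : V, σ.SameCycle (Sum.inl u) (Sum.inl t) := by
  have main := sameCycle_and_apply_eq_of_odd_minimalPeriod hσ
  exact ⟨(main s (hodd _)).2, fun u => (main u (hodd _)).1⟩
end

section
/- Let H be a finite cubic (3-regular) simple graph. Let D be the digraph whose vertex set is V(H) together with two new vertices w'_e and w''_e for every edge e of H, and whose arcs are, for every edge e of H with endpoints u and v, the six arcs (u, w'_e), (v, w'_e), (w''_e, u), (w''_e, v), (w'_e, w''_e), (w''_e, w'_e). Then D admits a (1,1)-factor all of whose cycles are even if and only if H admits a proper 3-edge-coloring. -/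
/-- Vertices of the auxiliary digraph `D`: the vertices of the cubic graph `H`
together with two new vertices `w'_e` (encoded as `(e, 0)`) and `w''_e`
(encoded as `(e, 1)`) for every edge `e` of `H`. -/
abbrev DVert3 (V : Type*) (G : SimpleGraph V) : Type _ := V ⊕ (G.edgeSet × Fin 2)

/-- Arcs of the auxiliary digraph `D`: for every edge `e` of `H` with endpoints `u, v`,
the six arcs `(u, w'_e)`, `(v, w'_e)`, `(w''_e, u)`, `(w''_e, v)`,
`(w'_e, w''_e)`, `(w''_e, w'_e)`. -/
def DArc3 {V : Type*} (G : SimpleGraph V) : DVert3 V G → DVert3 V G → Prop := fun x y =>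
  (∃ (e : G.edgeSet) (u : V), u ∈ (e : Sym2 V) ∧ x = Sum.inl u ∧ y = Sum.inr (e, 0)) ∨
  (∃ (e : G.edgeSet) (u : V), u ∈ (e : Sym2 V) ∧ x = Sum.inr (e, 1) ∧ y = Sum.inl u) ∨
  (∃ e : G.edgeSet, x = Sum.inr (e, 0) ∧ y = Sum.inr (e, 1)) ∨
  (∃ e : G.edgeSet, x = Sum.inr (e, 1) ∧ y = Sum.inr (e, 0))

/-- All cycles of a permutation are even iff its points can be two-coloured so that the
permutation swaps the two colours. -/
theorem even_minimalPeriod_iff_exists_alternating {α : Type*} (σ : Equiv.Perm α) :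
    (∀ x, Even (Function.minimalPeriod (⇑σ) x)) ↔ ∃ b : α → Bool, ∀ x, b (σ x) = !b x := by
  constructor
  · intro h
    let rep : α → α := fun x => (Quotient.mk (Equiv.Perm.SameCycle.setoid σ) x).out
    have hrep : ∀ x, ∃ i : ℤ, (σ ^ i) (rep x) = x := fun x =>
      Quotient.mk_out (s := Equiv.Perm.SameCycle.setoid σ) x
    have hrep_apply : ∀ x, rep (σ x) = rep x := fun x =>
      congrArg Quotient.out (Quotient.sound (s := Equiv.Perm.SameCycle.setoid σ)
        (show σ.SameCycle (σ x) x from (Equiv.Perm.sameCycle_apply_left).2 (.refl _ _)))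
    choose i hi using hrep
    refine ⟨fun x => decide (Even (i x)), fun x => ?_⟩
    have hfix : (σ ^ (i (σ x) - (i x + 1))) (rep x) = rep x := by
      have h1 := hi (σ x)
      rw [hrep_apply] at h1
      have h2 : (σ ^ (i x + 1)) (rep x) = σ x := by
        rw [add_comm, zpow_add, zpow_one, Equiv.Perm.mul_apply, hi]
      rw [sub_eq_neg_add, zpow_add, Equiv.Perm.mul_apply, h1, ← h2, zpow_neg]
      exact (σ ^ (i x + 1)).symm_apply_apply _
    have hdvd : (Function.minimalPeriod (⇑σ) (rep x) : ℤ) ∣ i (σ x) - (i x + 1) :=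
      MulAction.zpow_smul_eq_iff_minimalPeriod_dvd (a := σ).1 hfix
    have heven : Even (i (σ x) - (i x + 1)) :=
      even_iff_two_dvd.2 ((Int.natCast_dvd_natCast.2 (even_iff_two_dvd.1 (h (rep x)))).trans hdvd)
    by_cases hx : Even (i x) <;> simp_all [Int.even_sub]
  · rintro ⟨b, hb⟩ x
    have hiter : ∀ n : ℕ, b (σ^[n] x) = (b x ^^ decide (¬ Even n)) := by
      intro n
      induction n with
      | zero => simp
      | succ n ih =>
        rw [Function.iterate_succ_apply', hb, ih]
        by_cases hn : Even n <;> simp [hn, Nat.even_add_one]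
    have := hiter (Function.minimalPeriod (⇑σ) x)
    rw [Function.iterate_minimalPeriod] at this
    by_contra hodd
    simp [hodd] at this

/-- The union of two perfect matchings, given as fixed-point-free involutions, is bipartite. -/
theorem exists_bipartition_of_involutive {α : Type*} {f g : α → α}
    (hf : f.Involutive) (hg : g.Involutive) (hf' : ∀ x, f x ≠ x) (hg' : ∀ x, g x ≠ x) :
    ∃ b : α → Bool, (∀ x, b (f x) = !b x) ∧ ∀ x, b (g x) = !b x := by
  let F : Equiv.Perm α := hf.toPerm
  let ρ : Equiv.Perm α := F * hg.toPerm
  have hρ : ∀ x, ρ x = f (g x) := fun _ => rfl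
  have hsemi : SemiconjBy F ρ ρ⁻¹ := by
    rw [SemiconjBy, eq_inv_mul_iff_mul_eq]
    ext x
    change f (g (f (f (g x)))) = f x
    rw [hf, hg]
  have hconj : ∀ (k : ℤ) x, f ((ρ ^ k) x) = (ρ ^ (-k)) (f x) := by
    intro k x
    have := DFunLike.congr_fun (hsemi.zpow_right k) x
    rw [inv_zpow'] at this
    exact this
  have hne : ∀ x, ¬ ρ.SameCycle x (f x) := by
    rintro x ⟨k, hk⟩
    obtain ⟨j, rfl | rfl⟩ := Int.even_or_odd' k
    · apply hf' ((ρ ^ j) x)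
      rw [hconj, ← hk, ← Equiv.Perm.mul_apply, ← zpow_add]
      congr 2
      ring
    · apply hg' ((ρ ^ j) x)
      have h1 : g ((ρ ^ j) x) = f ((ρ ^ (1 + j)) x) := by
        rw [zpow_add, zpow_one, Equiv.Perm.mul_apply, hρ, hf]
      rw [h1, hconj, ← hk, ← Equiv.Perm.mul_apply, ← zpow_add]
      congr 2
      ring
  let q : α → Quotient (Equiv.Perm.SameCycle.setoid ρ) := Quotient.mk _
  have hq : ∀ {x y}, q x = q y ↔ ρ.SameCycle x y := fun {x y} =>
    Quotient.eq (r := Equiv.Perm.SameCycle.setoid ρ)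
  classical
  let : LinearOrder (Quotient (Equiv.Perm.SameCycle.setoid ρ)) :=
    linearOrderOfSTO WellOrderingRel
  have hflip : ∀ x, decide (q (f x) < q x) = !decide (q x < q (f x)) := by
    intro x
    rcases lt_or_gt_of_ne (fun h => hne x (hq.1 h)) with h | h <;> simp [h, h.not_gt]
  refine ⟨fun x => decide (q x < q (f x)), fun x => ?_, fun x => ?_⟩
  · simp only [hf x, hflip]
  · have h1 : q (g x) = q (f x) := hq.2 ⟨1, by rw [zpow_one, hρ, hg]⟩
    have h2 : q (f (g x)) = q x := hq.2 (Equiv.Perm.SameCycle.symm ⟨1, by rw [zpow_one, hρ]⟩)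
    simp only [h1, h2, hflip]

section Arcs

variable {V : Type*} {G : SimpleGraph V}

theorem DArc3_inl_iff {v : V} {y : DVert3 V G} :
    DArc3 G (Sum.inl v) y ↔ ∃ e : G.edgeSet, v ∈ (e : Sym2 V) ∧ y = Sum.inr (e, 0) := by
  simp [DArc3]

theorem DArc3_inr_zero_iff {e : G.edgeSet} {y : DVert3 V G} :
    DArc3 G (Sum.inr (e, 0)) y ↔ y = Sum.inr (e, 1) := by
  simp [DArc3]

theorem DArc3_inr_one_iff {e : G.edgeSet} {y : DVert3 V G} :
    DArc3 G (Sum.inr (e, 1)) y ↔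
      (∃ v : V, v ∈ (e : Sym2 V) ∧ y = Sum.inl v) ∨ y = Sum.inr (e, 0) := by
  simp only [DArc3, reduceCtorEq, Sum.inr.injEq, Prod.mk.injEq]
  aesop

end Arcs

theorem SimpleGraph.card_edgeSet_mem_eq_degree {V : Type*} [Fintype V] [DecidableEq V]
    (G : SimpleGraph V) [DecidableRel G.Adj] (v : V) :
    Nat.card {e : G.edgeSet // v ∈ (e : Sym2 V)} = G.degree v := by
  rw [← G.card_incidenceSet_eq_degree v, ← Nat.card_eq_fintype_card]
  exact Nat.card_congr (Equiv.subtypeSubtypeEquivSubtypeInter (· ∈ G.edgeSet) (v ∈ ·))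

theorem exists_three_edge_coloring_of_factor
    {V : Type*} [Fintype V] [DecidableEq V] (G : SimpleGraph V) [DecidableRel G.Adj]
    (hcubic : ∀ v : V, G.degree v = 3) (σ : Equiv.Perm (DVert3 V G))
    (hσ : ∀ x, DArc3 G x (σ x)) (heven : ∀ x, Even (Function.minimalPeriod (⇑σ) x)) :
    ∃ c : G.edgeSet → Fin 3, ∀ e f : G.edgeSet, e ≠ f →
      (∃ v : V, v ∈ (e : Sym2 V) ∧ v ∈ (f : Sym2 V)) → c e ≠ c f := by
  classical
  obtain ⟨b, hb⟩ := (even_minimalPeriod_iff_exists_alternating σ).1 heven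
  choose out hout_mem hout using fun v => DArc3_inl_iff.1 (hσ (Sum.inl v))
  have hzero : ∀ e, σ (Sum.inr (e, 0)) = Sum.inr (e, 1) := fun e => DArc3_inr_zero_iff.1 (hσ _)
  have hone := fun e => DArc3_inr_one_iff.1 (hσ (Sum.inr (e, 1)))
  have hin : ∀ v, ∃ e : G.edgeSet, v ∈ (e : Sym2 V) ∧ σ (Sum.inr (e, 1)) = Sum.inl v := by
    intro v
    obtain ⟨x, hx⟩ := σ.surjective (Sum.inl v)
    rcases x with u | ⟨e, i⟩
    · simp [hout] at hx
    · fin_cases i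
      · simp [hzero] at hx
      · refine ⟨e, ?_, hx⟩
        rcases hone e with ⟨u, hu, h⟩ | h
        · obtain rfl : u = v := by simpa [h] using hx
          exact hu
        · simp [h] at hx
  choose inn hinn_mem hinn using hin
  have hb_out : ∀ v, b (Sum.inr (out v, 0)) = !b (Sum.inl v) := fun v => by rw [← hout, hb]
  have hb_inn : ∀ v, b (Sum.inr (inn v, 0)) = b (Sum.inl v) := fun v => by
    rw [← hinn, hb, ← hzero, hb, Bool.not_not]
  have hne : ∀ v, out v ≠ inn v := fun v h => by
    have := hb_out v
    rw [h, hb_inn] at this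
    simp at this
  let loop : G.edgeSet → Prop := fun e => σ (Sum.inr (e, 1)) = Sum.inr (e, 0)
  have hloop_out : ∀ v, ¬ loop (out v) := fun v h => by
    have := σ.injective (h.trans (hout v).symm)
    simp at this
  have hloop_inn : ∀ v, ¬ loop (inn v) := fun v h => by simp [loop, hinn] at h
  have hcases : ∀ (e : G.edgeSet) (v : V), v ∈ (e : Sym2 V) → ¬ loop e →
      e = out v ∨ e = inn v := by
    intro e v hv he
    obtain ⟨u, hu, hσu⟩ := (hone e).resolve_right he
    have heu : e = inn u := by simpa using σ.injective (hσu.trans (hinn u).symm)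
    by_cases huv : u = v
    · exact Or.inr (huv ▸ heu)
    left
    obtain ⟨x, hx⟩ := σ.surjective (Sum.inr (e, 0))
    rcases x with w | ⟨f, i⟩
    · have hew : e = out w := by simpa [hout, eq_comm] using hx
      have hwe : w ∈ (e : Sym2 V) := hew ▸ hout_mem w
      rw [(Sym2.mem_and_mem_iff huv).1 ⟨hu, hv⟩, Sym2.mem_iff] at hwe
      rcases hwe with rfl | rfl
      · exact absurd (hew.symm.trans heu) (hne w)
      · exact hew
    · fin_cases i
      · simp [hzero] at hx
      · rcases hone f with ⟨w, -, h⟩ | h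
        · simp [h] at hx
        · obtain rfl : f = e := by simpa [h] using hx
          exact absurd h he
  have hloop_unique : ∀ (e f : G.edgeSet) (v : V), v ∈ (e : Sym2 V) → v ∈ (f : Sym2 V) →
      loop e → loop f → e = f := by
    intro e f v he hf hle hlf
    by_contra hef
    let S : Finset {e : G.edgeSet // v ∈ (e : Sym2 V)} :=
      {⟨e, he⟩, ⟨f, hf⟩, ⟨out v, hout_mem v⟩, ⟨inn v, hinn_mem v⟩}
    have hne_of : ∀ {a d}, loop a → ¬ loop d → a ≠ d := fun ha hd h => hd (h ▸ ha)
    have hS : S.card = 4 := by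
      simp [S, hef, hne v, hne_of hle (hloop_out v), hne_of hle (hloop_inn v),
        hne_of hlf (hloop_out v), hne_of hlf (hloop_inn v)]
    have := S.card_le_univ
    rw [hS, ← Nat.card_eq_fintype_card, G.card_edgeSet_mem_eq_degree, hcubic] at this
    omega
  refine ⟨fun e => if loop e then 2 else if b (Sum.inr (e, 0)) then 1 else 0, ?_⟩
  rintro e f hef ⟨v, hve, hvf⟩ hc
  by_cases hle : loop e <;> by_cases hlf : loop f
  · exact hef (hloop_unique e f v hve hvf hle hlf)
  · simp only [hle, hlf, if_true, if_false] at hc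
    split_ifs at hc <;> simp at hc
  · simp only [hle, hlf, if_true, if_false] at hc
    split_ifs at hc <;> simp at hc
  · have hbb : b (Sum.inr (e, 0)) = b (Sum.inr (f, 0)) := by
      simp only [hle, hlf, if_false] at hc
      split_ifs at hc <;> simp_all
    rcases hcases e v hve hle with rfl | rfl <;> rcases hcases f v hvf hlf with h | h
    · exact hef h.symm
    · simp [h, hb_out, hb_inn] at hbb
    · simp [h, hb_out, hb_inn] at hbb
    · exact hef h.symm

theorem exists_factor_of_three_edge_coloring
    {V : Type*} [Fintype V] [DecidableEq V] (G : SimpleGraph V) [DecidableRel G.Adj]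
    (hcubic : ∀ v : V, G.degree v = 3) (c : G.edgeSet → Fin 3)
    (hc : ∀ e f : G.edgeSet, e ≠ f →
      (∃ v : V, v ∈ (e : Sym2 V) ∧ v ∈ (f : Sym2 V)) → c e ≠ c f) :
    ∃ σ : Equiv.Perm (DVert3 V G),
      (∀ x, DArc3 G x (σ x)) ∧ ∀ x, Even (Function.minimalPeriod (⇑σ) x) := by
  classical
  have huniq : ∀ {e f : G.edgeSet} {v : V}, v ∈ (e : Sym2 V) → v ∈ (f : Sym2 V) →
      c e = c f → e = f := fun {e f v} he hf h => by
    by_contra hef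
    exact hc e f hef ⟨v, he, hf⟩ h
  have hex : ∀ (k : Fin 3) (v : V), ∃ e : G.edgeSet, v ∈ (e : Sym2 V) ∧ c e = k := by
    intro k v
    let cv : {e : G.edgeSet // v ∈ (e : Sym2 V)} → Fin 3 := fun e => c e
    have hinj : Function.Injective cv := fun e f h => Subtype.ext (huniq e.2 f.2 h)
    have hbij : Function.Bijective cv := (Fintype.bijective_iff_injective_and_card _).2 ⟨hinj, by
      rw [← Nat.card_eq_fintype_card, G.card_edgeSet_mem_eq_degree, hcubic, Fintype.card_fin]⟩
    obtain ⟨e, he⟩ := hbij.2 k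
    exact ⟨e, e.2, he⟩
  choose E hE_mem hE using hex
  choose M hM using fun k v => Sym2.mem_iff_exists.1 (hE_mem k v)
  have hM_mem : ∀ k v, M k v ∈ (E k v : Sym2 V) := fun k v => by
    rw [hM]
    exact Sym2.mem_mk_right _ _
  have hM_ne : ∀ k v, M k v ≠ v := fun k v h => by
    have := (E k v).2
    rw [hM, h] at this
    exact G.loopless.irrefl v this
  have hE_M : ∀ k v, E k (M k v) = E k v := fun k v =>
    huniq (hE_mem k (M k v)) (hM_mem k v) (by rw [hE, hE])
  have hM_inv : ∀ k, Function.Involutive (M k) := fun k v => by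
    have h := hM k (M k v)
    rw [hE_M, hM, Sym2.eq_swap] at h
    exact (Sym2.congr_right.1 h).symm
  obtain ⟨b, hb0, hb1⟩ :=
    exists_bipartition_of_involutive (hM_inv 0) (hM_inv 1) (hM_ne 0) (hM_ne 1)
  have hother : ∀ {e : G.edgeSet} {u v : V}, u ∈ (e : Sym2 V) → v ∈ (e : Sym2 V) → u ≠ v →
      v = M (c e) u := by
    intro e u v hu hv huv
    have h : e = E (c e) u := huniq hu (hE_mem _ u) (hE _ _).symm
    rw [h, hM, Sym2.mem_iff] at hv
    exact hv.resolve_left huv.symm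
  have hflip : ∀ {e : G.edgeSet} {u v : V}, u ∈ (e : Sym2 V) → v ∈ (e : Sym2 V) → c e ≠ 2 →
      b u = b v → u = v := by
    intro e u v hu hv he hbuv
    by_contra huv
    have hvM := hother hu hv huv
    have h01 : c e = 0 ∨ c e = 1 := by omega
    rcases h01 with h | h <;> rw [h] at hvM <;> rw [hvM] at hbuv <;> simp [hb0, hb1] at hbuv
  let o : V → Fin 3 := fun v => if b v then 0 else 1
  have ho : ∀ v, o v ≠ 2 := fun v => by
    simp only [o]
    split_ifs <;> decide
  have ho_inj : ∀ {u v}, o u = o v → b u = b v := fun {u v} h => by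
    cases hu : b u <;> cases hv : b v <;> simp [o, hu, hv] at h ⊢
  have hhead : ∀ e : G.edgeSet, ∃ v : V, v ∈ (e : Sym2 V) ∧ (c e ≠ 2 → o v ≠ c e) := by
    intro e
    obtain ⟨u, hu⟩ : ∃ u, u ∈ (e : Sym2 V) := ⟨_, Sym2.out_fst_mem _⟩
    by_cases hou : o u = c e
    · have hEu : E (c e) u = e := huniq (hE_mem _ u) hu (hE _ _)
      have hmem : M (c e) u ∈ (e : Sym2 V) := by
        have := hM_mem (c e) u
        rwa [hEu] at this
      exact ⟨_, hmem, fun he h => hM_ne _ _ (hflip hmem hu he (ho_inj (h.trans hou.symm)))⟩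
    · exact ⟨u, hu, fun _ => hou⟩
  choose head hhead_mem hhead using hhead
  obtain ⟨s, hs_inl, hs_zero, hs_one⟩ : ∃ s : DVert3 V G → DVert3 V G,
      (∀ v, s (Sum.inl v) = Sum.inr (E (o v) v, 0)) ∧
      (∀ e, s (Sum.inr (e, 0)) = Sum.inr (e, 1)) ∧
      ∀ e, s (Sum.inr (e, 1)) = if c e = 2 then Sum.inr (e, 0) else Sum.inl (head e) :=
    ⟨fun
      | Sum.inl v => Sum.inr (E (o v) v, 0)
      | Sum.inr (e, 0) => Sum.inr (e, 1)
      | Sum.inr (e, 1) => if c e = 2 then Sum.inr (e, 0) else Sum.inl (head e),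
      fun _ => rfl, fun _ => rfl, fun _ => rfl⟩
  have hs_arc : ∀ x, DArc3 G x (s x) := by
    rintro (v | ⟨e, i⟩)
    · exact DArc3_inl_iff.2 ⟨_, hE_mem _ v, hs_inl v⟩
    · fin_cases i
      · exact DArc3_inr_zero_iff.2 (hs_zero e)
      · refine DArc3_inr_one_iff.2 ?_
        by_cases he : c e = 2
        · exact Or.inr ((hs_one e).trans (if_pos he))
        · exact Or.inl ⟨head e, hhead_mem e, (hs_one e).trans (if_neg he)⟩
  have hs_inj : Function.Injective s := by
    have hout_inj : ∀ {u v}, E (o u) u = E (o v) v → u = v := fun {u v} h => by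
      have ho_eq : o u = o v := by rw [← hE (o u) u, h, hE]
      exact hflip (hE_mem (o u) u) (h ▸ hE_mem (o v) v) (by rw [hE]; exact ho u) (ho_inj ho_eq)
    have hout_ne : ∀ {v e}, c e = 2 → E (o v) v ≠ e := fun {v e} he h =>
      ho v (by rw [← hE (o v) v, h, he])
    have hhead_inj : ∀ {e f}, c e ≠ 2 → c f ≠ 2 → head e = head f → e = f := fun {e f} he hf h => by
      have h1 := hhead e he
      have h2 := hhead f hf
      have h3 := ho (head e)
      rw [← h] at h2
      exact huniq (hhead_mem e) (h ▸ hhead_mem f) (by omega)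
    rintro (u | ⟨e, i⟩) (v | ⟨f, j⟩) h
    · simp only [hs_inl, Sum.inr.injEq, Prod.mk.injEq, and_true] at h
      rw [hout_inj h]
    · fin_cases j
      · simp [hs_inl, hs_zero] at h
      · by_cases hf : c f = 2 <;> simp [hs_inl, hs_one, hf] at h
        exact absurd h (hout_ne hf)
    · fin_cases i
      · simp [hs_inl, hs_zero] at h
      · by_cases he : c e = 2 <;> simp [hs_inl, hs_one, he] at h
        exact absurd h.symm (hout_ne he)
    · fin_cases i <;> fin_cases j
      · simpa [hs_zero] using h
      · by_cases hf : c f = 2 <;> simp [hs_zero, hs_one, hf] at h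
      · by_cases he : c e = 2 <;> simp [hs_zero, hs_one, he] at h
      · by_cases he : c e = 2 <;> by_cases hf : c f = 2 <;> simp [hs_one, he, hf] at h
        · rw [h]
        · rw [hhead_inj he hf h]
  refine ⟨Equiv.ofBijective s (Finite.injective_iff_bijective.1 hs_inj), hs_arc,
    (even_minimalPeriod_iff_exists_alternating _).2 ?_⟩
  let β : DVert3 V G → Bool
    | Sum.inl v => b v
    | Sum.inr (e, 0) => decide (c e ≠ 0)
    | Sum.inr (e, 1) => decide (c e = 0)
  refine ⟨β, ?_⟩
  rintro (v | ⟨e, i⟩)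
  · change β (s _) = !b v
    rw [hs_inl]
    change decide (c (E (o v) v) ≠ 0) = !b v
    rw [hE]
    cases hv : b v <;> simp [o, hv]
  · fin_cases i
    · simp [β, hs_zero]
    · by_cases he : c e = 2
      · simp [β, hs_one, he]
      · have h := hhead e he
        have h01 : c e = 0 ∨ c e = 1 := by omega
        cases hv : b (head e) <;> rcases h01 with h' | h' <;>
          simp [o, hv, h'] at h <;> simp [β, hs_one, hv, h']

/-- For a finite cubic simple graph `H`, the digraph `D` admits a `(1,1)`-factor all of
whose cycles are even iff `H` admits a proper 3-edge-coloring. -/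
theorem allEven_factor_iff_three_edge_colorable
    {V : Type*} [Fintype V] [DecidableEq V] (G : SimpleGraph V) [DecidableRel G.Adj]
    (hcubic : ∀ v : V, G.degree v = 3) :
    (∃ σ : Equiv.Perm (DVert3 V G),
        (∀ x, DArc3 G x (σ x)) ∧
        ∀ x, Even (Function.minimalPeriod (⇑σ) x)) ↔
    (∃ c : G.edgeSet → Fin 3, ∀ e f : G.edgeSet, e ≠ f →
        (∃ v : V, v ∈ (e : Sym2 V) ∧ v ∈ (f : Sym2 V)) → c e ≠ c f) :=
  ⟨fun ⟨σ, hσ, heven⟩ => exists_three_edge_coloring_of_factor G hcubic σ hσ heven,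
    fun ⟨c, hc⟩ => exists_factor_of_three_edge_coloring G hcubic c hc⟩
end

section
/- Let H be a finite digraph and let s1, t1, s2, t2 be four pairwise distinct vertices of H. Let D be the digraph whose vertex set consists of two vertices x1_v, x2_v for every v ∈ V(H) together with two additional vertices y1 and y2, and whose arcs are: (x1_v, x2_v) and (x2_v, x1_v) for every v ∈ V(H); (x2_u, x1_v) for every arc (u,v) of H; and (x2_{t_i}, y_i) and (y_i, x1_{s_i}) for i = 1, 2. Then D admits a (1,1)-factor containing at least one odd cycle if and only if H contains a directed (s1,t1)-path P1 and a directed (s2,t2)-path P2 that are vertex-disjoint. -/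
/-- Vertices of the auxiliary digraph `D`: two vertices `x1_v = (v, 0)` and
`x2_v = (v, 1)` for every vertex `v` of `H`, together with two additional vertices
`y1 = Sum.inr 0` and `y2 = Sum.inr 1`. -/
abbrev DVert6 (V : Type*) : Type _ := (V × Fin 2) ⊕ Fin 2

/-- Arcs of the auxiliary digraph `D`: `(x1_v, x2_v)` and `(x2_v, x1_v)` for every
vertex `v` of `H`; `(x2_u, x1_v)` for every arc `(u, v)` of `H`; and
`(x2_{t_i}, y_i)`, `(y_i, x1_{s_i})` for `i = 1, 2`. -/
def DArc6 {V : Type*} (A : V → V → Prop) (s₁ t₁ s₂ t₂ : V) :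
    DVert6 V → DVert6 V → Prop := fun x y =>
  (∃ v, x = Sum.inl (v, 0) ∧ y = Sum.inl (v, 1)) ∨
  (∃ v, x = Sum.inl (v, 1) ∧ y = Sum.inl (v, 0)) ∨
  (∃ u v, A u v ∧ x = Sum.inl (u, 1) ∧ y = Sum.inl (v, 0)) ∨
  (x = Sum.inl (t₁, 1) ∧ y = Sum.inr 0) ∨
  (x = Sum.inr 0 ∧ y = Sum.inl (s₁, 0)) ∨
  (x = Sum.inl (t₂, 1) ∧ y = Sum.inr 1) ∨
  (x = Sum.inr 1 ∧ y = Sum.inl (s₂, 0))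

/-- A walk can be shortened to a path visiting each vertex at most once. -/
theorem Relation.ReflTransGen.exists_injective_chain {α : Type*} {r : α → α → Prop} {a b : α}
    (h : Relation.ReflTransGen r a b) :
    ∃ (n : ℕ) (f : Fin (n + 1) → α), Function.Injective f ∧ f 0 = a ∧ f (Fin.last n) = b ∧
      ∀ i : Fin n, r (f i.castSucc) (f i.succ) := by
  induction h using Relation.ReflTransGen.head_induction_on with
  | refl => exact ⟨0, fun _ => b, fun i j _ => by omega, rfl, rfl, fun i => i.elim0⟩
  | @head a c hac _ ih =>
    obtain ⟨n, f, hf, h0, hl, hr⟩ := ih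
    by_cases ha : a ∈ Set.range f
    · obtain ⟨k, rfl⟩ := ha
      refine ⟨n - k, fun i => f ⟨k + i, by omega⟩, ?_, ?_, ?_, ?_⟩
      · intro i j hij
        have := congrArg Fin.val (hf hij)
        ext
        simpa using this
      · simp
      · rw [← hl]
        exact congrArg f (Fin.ext (by simp; omega))
      · intro i
        exact hr ⟨k + i, by omega⟩
    · refine ⟨n + 1, Fin.cons a f, Fin.cons_injective_iff.2 ⟨ha, hf⟩, rfl, ?_, ?_⟩
      · rw [← Fin.succ_last, Fin.cons_succ, hl]
      · intro i
        induction i using Fin.cases with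
        | zero => simpa [h0] using hac
        | succ i => simpa [← Fin.succ_castSucc] using hr i

/-- A two-coloring that alternates along `f` except when leaving `y` or `z` forces every
cycle of odd length to contain exactly one of `y` and `z`. -/
theorem Equiv.Perm.not_sameCycle_of_odd_minimalPeriod {α : Type*} [Finite α]
    (σ : Equiv.Perm α) (c : α → ZMod 2) {x y z : α} (hyz : y ≠ z)
    (hy : c (σ y) = c y) (hz : c (σ z) = c z)
    (hc : ∀ w, w ≠ y → w ≠ z → c (σ w) = c w + 1)
    (hx : Odd (Function.minimalPeriod σ x)) : ¬ σ.SameCycle y z := by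
  classical
  intro hs
  have key (w : α) : c (σ w) - c w = 1 - ((if w = y then 1 else 0) + (if w = z then 1 else 0)) := by
    by_cases h1 : w = y
    · subst h1; simp [hy, hyz]
    · by_cases h2 : w = z
      · subst h2; simp [hz, h1]
      · simp [hc w h1 h2, h1, h2]
  have count (w : α) : ∑ n ∈ Finset.range (Function.minimalPeriod σ x),
      (if σ^[n] x = w then (1 : ZMod 2) else 0) = if σ.SameCycle x w then 1 else 0 := by
    split_ifs with h
    · obtain ⟨m, hm⟩ := h.exists_nat_pow_eq
      rw [Equiv.Perm.coe_pow] at hm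
      have hp := hx.pos
      rw [← Function.iterate_mod_minimalPeriod_eq] at hm
      rw [Finset.sum_eq_single_of_mem _ (Finset.mem_range.2 (Nat.mod_lt m hp)), if_pos hm]
      intro b hb hne
      rw [if_neg]
      intro hbw
      exact hne (Function.iterate_injOn_Iio_minimalPeriod (Finset.mem_range.1 hb)
        (Nat.mod_lt m hp) (hbw.trans hm.symm))
    · refine Finset.sum_eq_zero fun n _ => if_neg fun hn => h ⟨n, ?_⟩
      rw [zpow_natCast, Equiv.Perm.coe_pow, hn]
  have tel := Finset.sum_range_sub (fun n => c (σ^[n] x)) (Function.minimalPeriod σ x)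
  simp only [Function.iterate_succ_apply', key, Function.iterate_minimalPeriod,
    Function.iterate_zero, id, sub_self, Finset.sum_sub_distrib, Finset.sum_add_distrib,
    count] at tel
  have hiff : σ.SameCycle x y ↔ σ.SameCycle x z := ⟨fun h => h.trans hs, fun h => h.trans hs.symm⟩
  simp only [hiff, CharTwo.add_self_eq_zero, Finset.sum_const, Finset.card_range, nsmul_eq_mul,
    mul_one, sub_zero] at tel
  exact Nat.not_even_iff_odd.2 hx ((ZMod.natCast_eq_zero_iff_even).1 tel)

/-- The cyclic permutation along an injective sequence. -/
theorem Equiv.Perm.exists_cyclic_extension {α : Type*} {n : ℕ} {f : Fin (n + 1) → α}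
    (hf : Function.Injective f) :
    ∃ ρ : Equiv.Perm α, (∀ i : Fin n, ρ (f i.castSucc) = f i.succ) ∧
      ρ (f (Fin.last n)) = f 0 ∧ ∀ v ∉ Set.range f, ρ v = v := by
  refine ⟨(finRotate (n + 1)).viaEmbedding ⟨f, hf⟩, fun i => ?_, ?_, fun v hv => ?_⟩
  · have := Equiv.Perm.viaEmbedding_apply (finRotate (n + 1)) ⟨f, hf⟩ i.castSucc
    simpa using this
  · have := Equiv.Perm.viaEmbedding_apply (finRotate (n + 1)) ⟨f, hf⟩ (Fin.last n)
    simpa using this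
  · exact Equiv.Perm.viaEmbedding_apply_of_notMem _ _ _ hv

section

variable {V : Type*} {A : V → V → Prop} {s₁ t₁ s₂ t₂ : V}

theorem DArc6.eq_inl_one {v : V} {y : DVert6 V}
    (h : DArc6 A s₁ t₁ s₂ t₂ (Sum.inl (v, 0)) y) : y = Sum.inl (v, 1) := by
  simp [DArc6] at h
  exact h

theorem DArc6.of_inl_one {v : V} {y : DVert6 V}
    (h : DArc6 A s₁ t₁ s₂ t₂ (Sum.inl (v, 1)) y) :
    (∃ w, (w = v ∨ A v w) ∧ y = Sum.inl (w, 0)) ∨ ∃ i, y = Sum.inr i := by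
  simp [DArc6] at h
  grind

theorem DArc6.eq_of_inr_zero {y : DVert6 V}
    (h : DArc6 A s₁ t₁ s₂ t₂ (Sum.inr 0) y) : y = Sum.inl (s₁, 0) := by
  simpa [DArc6] using h

theorem DArc6.eq_of_inr_one {y : DVert6 V}
    (h : DArc6 A s₁ t₁ s₂ t₂ (Sum.inr 1) y) : y = Sum.inl (s₂, 0) := by
  simpa [DArc6] using h

theorem DArc6.eq_of_to_inr_zero {x : DVert6 V}
    (h : DArc6 A s₁ t₁ s₂ t₂ x (Sum.inr 0)) : x = Sum.inl (t₁, 1) := by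
  simpa [DArc6] using h

theorem DArc6.eq_of_to_inr_one {x : DVert6 V}
    (h : DArc6 A s₁ t₁ s₂ t₂ x (Sum.inr 1)) : x = Sum.inl (t₂, 1) := by
  simpa [DArc6] using h

/-- If `inr k` is the only additional vertex on its cycle, that cycle traces out a path of `H`. -/
theorem exists_path_of_cycle [Finite V] (σ : Equiv.Perm (DVert6 V)) {k : Fin 2} {s t : V}
    (h0 : ∀ v, σ (Sum.inl (v, 0)) = Sum.inl (v, 1))
    (h1 : ∀ v, (∃ w, (w = v ∨ A v w) ∧ σ (Sum.inl (v, 1)) = Sum.inl (w, 0)) ∨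
      ∃ i, σ (Sum.inl (v, 1)) = Sum.inr i)
    (hs : σ (Sum.inr k) = Sum.inl (s, 0)) (ht : σ (Sum.inl (t, 1)) = Sum.inr k)
    (hk : ∀ i, σ.SameCycle (Sum.inr k) (Sum.inr i) → i = k) :
    ∃ (n : ℕ) (f : Fin (n + 1) → V), Function.Injective f ∧ f 0 = s ∧ f (Fin.last n) = t ∧
      (∀ i : Fin n, A (f i.castSucc) (f i.succ)) ∧
      ∀ i, σ.SameCycle (Sum.inr k) (Sum.inl (f i, 0)) := by
  let r : V → V → Prop := fun u v => A u v ∧ σ.SameCycle (Sum.inr k) (Sum.inl (v, 0))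
  have reach (n : ℕ) : ∀ v i, (σ ^ n) (Sum.inr k) = Sum.inl (v, i) →
      Relation.ReflTransGen r s v := by
    induction n with
    | zero => intro v i h; simp at h
    | succ n ih =>
      intro v i h
      have hc : σ.SameCycle (Sum.inr k) ((σ ^ n) (Sum.inr k)) := ⟨n, by simp⟩
      have hc' : σ.SameCycle (Sum.inr k) (Sum.inl (v, i)) := ⟨(n + 1 : ℕ), by rw [zpow_natCast, h]⟩
      rw [pow_succ', Equiv.Perm.mul_apply] at h
      rcases hz : (σ ^ n) (Sum.inr k) with ⟨u, j⟩ | j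
      · have hu := ih u j hz
        rw [hz] at h
        fin_cases j
        · have : u = v := by
            have := (h0 u).symm.trans h
            simp at this
            exact this.1
          exact this ▸ hu
        · rcases h1 u with ⟨w, hw, hw'⟩ | ⟨j, hj⟩
          · have := hw'.symm.trans h
            simp at this
            obtain ⟨rfl, rfl⟩ := this
            rcases hw with rfl | hw
            · exact hu
            · exact hu.tail ⟨hw, hc'⟩
          · have := hj.symm.trans h
            simp at this
      · rw [hz] at hc h
        obtain rfl := hk j hc
        rw [hs] at h
        simp at h
        exact h.1 ▸ .refl
  have hcyc : σ.SameCycle (Sum.inr k) (Sum.inl (t, 1)) := by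
    rw [← Equiv.Perm.sameCycle_apply_right, ht]
  obtain ⟨m, hm⟩ := hcyc.exists_nat_pow_eq
  obtain ⟨n, f, hf, hf0, hfl, hr⟩ := (reach m t 1 hm).exists_injective_chain
  refine ⟨n, f, hf, hf0, hfl, fun i => (hr i).1, fun i => ?_⟩
  induction i using Fin.cases with
  | zero => rw [hf0, ← hs, Equiv.Perm.sameCycle_apply_right]
  | succ i => exact (hr i).2

/-- Following `ρ` along a path, with `inr k` inserted between its end and its start, gives an
odd cycle. -/
theorem odd_minimalPeriod_of_path (σ : DVert6 V → DVert6 V) {k : Fin 2} {n : ℕ}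
    {f : Fin (n + 1) → V}
    (h0 : ∀ v, σ (Sum.inl (v, 0)) = Sum.inl (v, 1))
    (h1 : ∀ i : Fin n, σ (Sum.inl (f i.castSucc, 1)) = Sum.inl (f i.succ, 0))
    (hs : σ (Sum.inr k) = Sum.inl (f 0, 0)) (ht : σ (Sum.inl (f (Fin.last n), 1)) = Sum.inr k) :
    Odd (Function.minimalPeriod σ (Sum.inr k)) := by
  have walk (i : Fin (n + 1)) : σ^[2 * i.val + 1] (Sum.inr k) = Sum.inl (f i, 0) := by
    induction i using Fin.induction with
    | zero => simpa using hs
    | succ i ih =>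
      rw [Fin.val_succ, show 2 * (i.val + 1) + 1 = 2 * i.castSucc.val + 1 + 1 + 1 by simp; ring,
        Function.iterate_succ_apply', Function.iterate_succ_apply', ih, h0, h1]
  have hper : Function.IsPeriodicPt σ (2 * n + 1 + 1 + 1) (Sum.inr k) := by
    have := walk (Fin.last n)
    rw [Fin.val_last] at this
    rw [Function.IsPeriodicPt, Function.IsFixedPt, Function.iterate_succ_apply',
      Function.iterate_succ_apply', this, h0, ht]
  exact Odd.of_dvd_nat ⟨n + 1, by ring⟩ hper.minimalPeriod_dvd

open scoped Classical in
/-- The self-map of the vertices of `D` induced by a self-map `ρ` of the vertices of `H`. -/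
noncomputable def factorMap (ρ : V → V) (s₁ t₁ s₂ t₂ : V) : DVert6 V → DVert6 V
  | Sum.inl (v, i) =>
    if i = 0 then Sum.inl (v, 1)
    else if v = t₁ then Sum.inr 0
    else if v = t₂ then Sum.inr 1
    else Sum.inl (ρ v, 0)
  | Sum.inr i => if i = 0 then Sum.inl (s₁, 0) else Sum.inl (s₂, 0)

theorem factorMap_injective {ρ : V → V} (hρ : Function.Injective ρ) (h₁ : ρ t₁ = s₁)
    (h₂ : ρ t₂ = s₂) (hs : s₁ ≠ s₂) : Function.Injective (factorMap ρ s₁ t₁ s₂ t₂) := by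
  have inj := @hρ
  rintro (⟨v, i⟩ | i) (⟨w, j⟩ | j) h <;> fin_cases i <;> fin_cases j <;>
    simp [factorMap] at h ⊢ <;> grind

theorem dArc6_factorMap {ρ : V → V}
    (hρ : ∀ v, v ≠ t₁ → v ≠ t₂ → ρ v = v ∨ A v (ρ v)) (x : DVert6 V) :
    DArc6 A s₁ t₁ s₂ t₂ x (factorMap ρ s₁ t₁ s₂ t₂ x) := by
  rcases x with ⟨v, i⟩ | i <;> fin_cases i
  · simp [factorMap, DArc6]
  · by_cases hv₁ : v = t₁
    · simp [factorMap, DArc6, hv₁]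
    · by_cases hv₂ : v = t₂
      · subst hv₂
        simp [factorMap, DArc6, hv₁]
      · have := hρ v hv₁ hv₂
        simp [factorMap, DArc6, hv₁, hv₂]
        grind
  · simp [factorMap, DArc6]
  · simp [factorMap, DArc6]

end

/-- `D` admits a `(1,1)`-factor containing at least one odd cycle iff `H` contains
vertex-disjoint directed `(s₁, t₁)`- and `(s₂, t₂)`-paths. -/
theorem existsOdd_factor_iff_two_disjoint_paths
    {V : Type*} [Fintype V] (A : V → V → Prop) (hA : Irreflexive A)
    (s₁ t₁ s₂ t₂ : V) (hdist : [s₁, t₁, s₂, t₂].Pairwise (· ≠ ·)) :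
    (∃ σ : Equiv.Perm (DVert6 V),
        (∀ x, DArc6 A s₁ t₁ s₂ t₂ x (σ x)) ∧
        ∃ x, Odd (Function.minimalPeriod (⇑σ) x)) ↔
    (∃ (n₁ n₂ : ℕ) (f : Fin (n₁ + 1) → V) (g : Fin (n₂ + 1) → V),
        Function.Injective f ∧ Function.Injective g ∧
        f 0 = s₁ ∧ f (Fin.last n₁) = t₁ ∧
        g 0 = s₂ ∧ g (Fin.last n₂) = t₂ ∧
        (∀ i : Fin n₁, A (f i.castSucc) (f i.succ)) ∧
        (∀ i : Fin n₂, A (g i.castSucc) (g i.succ)) ∧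
        ∀ i j, f i ≠ g j) := by
  constructor
  · rintro ⟨σ, hσ, x, hx⟩
    have h0 (v : V) := (hσ (Sum.inl (v, 0))).eq_inl_one
    have h1 (v : V) := (hσ (Sum.inl (v, 1))).of_inl_one
    have hs₁ := (hσ (Sum.inr 0)).eq_of_inr_zero
    have hs₂ := (hσ (Sum.inr 1)).eq_of_inr_one
    have ht₁ : σ (Sum.inl (t₁, 1)) = Sum.inr 0 := by
      have := hσ (σ.symm (Sum.inr 0))
      rw [Equiv.apply_symm_apply] at this
      rw [← this.eq_of_to_inr_zero, Equiv.apply_symm_apply]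
    have ht₂ : σ (Sum.inl (t₂, 1)) = Sum.inr 1 := by
      have := hσ (σ.symm (Sum.inr 1))
      rw [Equiv.apply_symm_apply] at this
      rw [← this.eq_of_to_inr_one, Equiv.apply_symm_apply]
    have hdisj : ¬ σ.SameCycle (Sum.inr 0) (Sum.inr 1) := by
      refine σ.not_sameCycle_of_odd_minimalPeriod
        (Sum.elim (fun p => if p.2 = 0 then 0 else 1) fun _ => 0) (by simp) (by simp [hs₁])
        (by simp [hs₂]) ?_ hx
      rintro (⟨v, i⟩ | i) hy hz
      · fin_cases i
        · simp [h0]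
        · rcases h1 v with ⟨w, -, hw⟩ | ⟨i, hi⟩
          · simp [hw, CharTwo.add_self_eq_zero]
          · simp [hi, CharTwo.add_self_eq_zero]
      · fin_cases i <;> simp at hy hz
    obtain ⟨n₁, f, hf, hf0, hfl, hfA, hfc⟩ := exists_path_of_cycle σ h0 h1 hs₁ ht₁ (by
      intro i hi
      fin_cases i
      · rfl
      · exact absurd hi hdisj)
    obtain ⟨n₂, g, hg, hg0, hgl, hgA, hgc⟩ := exists_path_of_cycle σ h0 h1 hs₂ ht₂ (by
      intro i hi
      fin_cases i
      · exact absurd hi.symm hdisj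
      · rfl)
    exact ⟨n₁, n₂, f, g, hf, hg, hf0, hfl, hg0, hgl, hfA, hgA, fun i j hij =>
      hdisj ((hfc i).trans (hij ▸ (hgc j).symm))⟩
  · rintro ⟨n₁, n₂, f, g, hf, hg, rfl, rfl, rfl, rfl, hfA, hgA, hfg⟩
    obtain ⟨ρ, hρ, hρl, hρ'⟩ := Equiv.Perm.exists_cyclic_extension hf
    obtain ⟨τ, hτ, hτl, hτ'⟩ := Equiv.Perm.exists_cyclic_extension hg
    have hf' (i) : (ρ * τ) (f i) = ρ (f i) := by
      rw [Equiv.Perm.mul_apply, hτ' _ fun ⟨j, hj⟩ => hfg i j hj.symm]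
    have hg' (i : Fin n₂) : (ρ * τ) (g i.castSucc) = g i.succ := by
      rw [Equiv.Perm.mul_apply, hτ, hρ' _ fun ⟨j, hj⟩ => hfg j _ hj]
    have hgl' : (ρ * τ) (g (Fin.last n₂)) = g 0 := by
      rw [Equiv.Perm.mul_apply, hτl, hρ' _ fun ⟨j, hj⟩ => hfg j _ hj]
    have hinj := factorMap_injective (ρ * τ).injective ((hf' _).trans hρl) hgl' (hfg 0 0)
    refine ⟨Equiv.ofBijective _ (Finite.injective_iff_bijective.1 hinj),
      dArc6_factorMap fun v hv₁ hv₂ => ?_, Sum.inr 0, ?_⟩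
    · by_cases hvf : v ∈ Set.range f
      · obtain ⟨i, rfl⟩ := hvf
        obtain ⟨i, rfl⟩ := Fin.exists_castSucc_eq.2 fun h => hv₁ (congrArg f h)
        exact .inr (by rw [hf', hρ]; exact hfA i)
      · by_cases hvg : v ∈ Set.range g
        · obtain ⟨i, rfl⟩ := hvg
          obtain ⟨i, rfl⟩ := Fin.exists_castSucc_eq.2 fun h => hv₂ (congrArg g h)
          exact .inr (by rw [hg']; exact hgA i)
        · exact .inl (by rw [Equiv.Perm.mul_apply, hτ' v hvg, hρ' v hvf])
    · refine odd_minimalPeriod_of_path (f := f) _ (fun v => ?_) (fun i => ?_) ?_ ?_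
      · simp [factorMap]
      · have h₁ : f i.castSucc ≠ f (Fin.last n₁) := hf.ne (Fin.castSucc_lt_last i).ne
        have := hf' i.castSucc
        rw [Equiv.Perm.mul_apply] at this
        simp [factorMap, h₁, hfg, this, hρ]
      · simp [factorMap]
      · simp [factorMap]
end

section
/- Let H be a finite digraph and let s1, t1, s2, t2 be four pairwise distinct vertices of H, and let D be the digraph whose vertex set consists of two vertices x1_v, x2_v for every v ∈ V(H) together with two additional vertices y1 and y2, and whose arcs are: (x1_v, x2_v) and (x2_v, x1_v) for every v ∈ V(H); (x2_u, x1_v) for every arc (u,v) of H; and (x2_{t_i}, y_i) and (y_i, x1_{s_i}) for i = 1, 2. Then for every (1,1)-factor σ of D and every cycle C of σ, the cycle C is odd if and only if C contains exactly one of the two vertices y1, y2. -/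
/-- The number of points on the cycle of `σ` through `x` is the minimal period of `x`. -/
theorem Equiv.Perm.card_filter_sameCycle {α : Type*} [Fintype α] (σ : Equiv.Perm α) (x : α)
    [DecidablePred (σ.SameCycle x)] :
    (Finset.univ.filter (σ.SameCycle x)).card = Function.minimalPeriod σ x := by
  have h : (MulAction.orbit (Subgroup.zpowers σ) x) = {y | σ.SameCycle x y} := by
    ext y
    simp [MulAction.mem_orbit_iff, Equiv.Perm.SameCycle, Subgroup.exists_zpowers,
      Subgroup.smul_def]
  have hp : Function.minimalPeriod σ x = Nat.card (MulAction.orbit (Subgroup.zpowers σ) x) := by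
    have : Fintype (MulAction.orbit (Subgroup.zpowers σ) x) := Fintype.ofFinite _
    rw [Nat.card_eq_fintype_card]
    exact MulAction.minimalPeriod_eq_card (a := σ) (b := x)
  rw [hp, h, Nat.card_coe_set_eq, ← Set.ncard_coe_finset]
  simp

/-- A potential on the vertices of `D` which changes parity along every arc whose head is not
one of `y1, y2`. -/
def DVert6.parity {V : Type*} : DVert6 V → ZMod 2 :=
  Sum.elim (fun p => if p.2 = 0 then 0 else 1) fun _ => 1

theorem DArc6.parity_eq {V : Type*} [DecidableEq V] {A : V → V → Prop} {s₁ t₁ s₂ t₂ : V}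
    {x y : DVert6 V} (h : DArc6 A s₁ t₁ s₂ t₂ x y) :
    DVert6.parity y = DVert6.parity x + 1 +
      ((if y = Sum.inr 0 then 1 else 0) + if y = Sum.inr 1 then 1 else 0) := by
  rcases h with ⟨v, rfl, rfl⟩ | ⟨v, rfl, rfl⟩ | ⟨u, v, -, rfl, rfl⟩ | ⟨rfl, rfl⟩ | ⟨rfl, rfl⟩ |
    ⟨rfl, rfl⟩ | ⟨rfl, rfl⟩ <;> simp [DVert6.parity] <;> decide

/-- For every `(1,1)`-factor `σ` of `D` and every cycle of `σ` (the cycle through a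
vertex `x`), the cycle is odd iff it contains exactly one of the two vertices
`y1, y2`. -/
theorem factor_cycle_odd_iff_exactly_one_y
    {V : Type*} [Fintype V] (A : V → V → Prop) (hA : Irreflexive A)
    (s₁ t₁ s₂ t₂ : V) (hdist : [s₁, t₁, s₂, t₂].Pairwise (· ≠ ·))
    (σ : Equiv.Perm (DVert6 V)) (hσ : ∀ x, DArc6 A s₁ t₁ s₂ t₂ x (σ x)) :
    ∀ x : DVert6 V,
      Odd (Function.minimalPeriod (⇑σ) x) ↔
      Xor' (σ.SameCycle x (Sum.inr 0)) (σ.SameCycle x (Sum.inr 1)) := by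
  classical
  intro x
  set S := Finset.univ.filter (σ.SameCycle x) with hS
  have reindex (f : DVert6 V → ZMod 2) : ∑ z ∈ S, f (σ z) = ∑ z ∈ S, f z :=
    Finset.sum_equiv σ (by simp [hS]) (by simp)
  have hsum := Finset.sum_congr rfl fun z (_ : z ∈ S) => (hσ z).parity_eq
  rw [Finset.sum_add_distrib, Finset.sum_add_distrib, reindex,
    reindex fun y => (if y = Sum.inr 0 then 1 else 0) + if y = Sum.inr 1 then 1 else 0,
    Finset.sum_add_distrib, Finset.sum_ite_eq', Finset.sum_ite_eq', Finset.sum_const,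
    nsmul_one, hS, σ.card_filter_sameCycle x, add_assoc, left_eq_add] at hsum
  simp only [Finset.mem_filter, Finset.mem_univ, true_and] at hsum
  rw [← ZMod.natCast_eq_one_iff_odd]
  generalize (Function.minimalPeriod σ x : ZMod 2) = n at hsum ⊢
  by_cases h₀ : σ.SameCycle x (Sum.inr 0) <;> by_cases h₁ : σ.SameCycle x (Sum.inr 1) <;>
    simp only [h₀, h₁, if_true, if_false, Xor'] at hsum ⊢ <;> revert n <;> decide
end

section
/- Let H be a finite digraph. Let D be the digraph whose vertex set consists of six vertices v, v1, v2, v3, v4, v5 for every vertex v of H, and whose arcs are: all arcs of H (on the vertices v), and for every v ∈ V(H) the eight arcs (v, v1), (v1, v2), (v2, v), (v3, v4), (v4, v5), (v5, v3), (v2, v3), (v5, v1). Then D admits a (1,1)-factor containing at least one even cycle if and only if H contains an even directed cycle. -/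
/-- Arcs of the auxiliary digraph `D` on vertex set `V × Fin 6`, where for a vertex
`v` of `H` we encode `v = (v, 0)`, `v1 = (v, 1)`, ..., `v5 = (v, 5)`:
all arcs of `H` (between the `(·, 0)` vertices), and for every `v` the eight arcs
`(v, v1)`, `(v1, v2)`, `(v2, v)`, `(v3, v4)`, `(v4, v5)`, `(v5, v3)`, `(v2, v3)`,
`(v5, v1)`. -/
def DArc8 {V : Type*} (A : V → V → Prop) : V × Fin 6 → V × Fin 6 → Prop := fun x y =>
  (A x.1 y.1 ∧ x.2 = 0 ∧ y.2 = 0) ∨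
  (x.1 = y.1 ∧
    ((x.2, y.2) = ((0 : Fin 6), (1 : Fin 6)) ∨ (x.2, y.2) = (1, 2) ∨
     (x.2, y.2) = (2, 0) ∨ (x.2, y.2) = (3, 4) ∨ (x.2, y.2) = (4, 5) ∨
     (x.2, y.2) = (5, 3) ∨ (x.2, y.2) = (2, 3) ∨ (x.2, y.2) = (5, 1)))

/-- The successor map on the vertices of an auxiliary digraph `D`, where the vertices in `S` follow
the permutation `π` of the original digraph and their gadget vertices form a 5-cycle, while every
other vertex is covered together with its gadget by two 3-cycles. -/
noncomputable def gadgetMap {V : Type*} (S : Set V) (π : V → V) (x : V × Fin 6) : V × Fin 6 :=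
  open Classical in
  if x.1 ∈ S then (if x.2 = 0 then (π x.1, 0) else (x.1, ![0, 2, 3, 4, 5, 1] x.2))
  else (x.1, ![1, 2, 0, 4, 5, 3] x.2)

theorem gadgetMap_injective {V : Type*} {S : Set V} {π : V → V} (hπ : Function.Injective π)
    (hS : Set.MapsTo π S S) : Function.Injective (gadgetMap S π) := by
  have key₁ : ∀ i j : Fin 6, (![1, 2, 0, 4, 5, 3] : Fin 6 → Fin 6) i = ![1, 2, 0, 4, 5, 3] j →
      i = j := by decide
  have key₂ : ∀ i j : Fin 6, (![0, 2, 3, 4, 5, 1] : Fin 6 → Fin 6) i = ![0, 2, 3, 4, 5, 1] j →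
      i = j := by decide
  have key₃ : ∀ i : Fin 6, (![0, 2, 3, 4, 5, 1] : Fin 6 → Fin 6) i = 0 → i = 0 := by decide
  rintro ⟨v, i⟩ ⟨w, j⟩ h
  have hv := @hS v
  have hw := @hS w
  have hvw := @hπ v w
  have h₁ := key₁ i j
  have h₂ := key₂ i j
  have h₃ := key₃ i
  have h₄ := key₃ j
  clear key₁ key₂ key₃
  simp only [gadgetMap] at h
  split_ifs at h <;> simp only [Prod.mk.injEq] at h ⊢ <;> grind

theorem dArc8_gadgetMap {V : Type*} {A : V → V → Prop} {S : Set V} {π : V → V}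
    (h : ∀ v ∈ S, A v (π v)) (x : V × Fin 6) : DArc8 A x (gadgetMap S π x) := by
  obtain ⟨v, i⟩ := x
  by_cases hv : v ∈ S
  · have := h v hv
    fin_cases i <;> simp [gadgetMap, DArc8, hv, this]
  · fin_cases i <;> simp [gadgetMap, DArc8, hv]

section Factor

variable {V : Type*} {A : V → V → Prop} {σ : Equiv.Perm (V × Fin 6)}

theorem apply_of_dArc8 (hσ : ∀ x, DArc8 A x (σ x)) (v : V) :
    σ (v, 1) = (v, 2) ∧ σ (v, 3) = (v, 4) ∧ σ (v, 4) = (v, 5) ∧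
      (σ (v, 2) = (v, 0) ∨ σ (v, 2) = (v, 3)) ∧ (σ (v, 5) = (v, 3) ∨ σ (v, 5) = (v, 1)) ∧
      (σ (v, 0) = (v, 1) ∨ ∃ w, A v w ∧ σ (v, 0) = (w, 0)) := by
  have h0 := hσ (v, 0)
  have h1 := hσ (v, 1)
  have h2 := hσ (v, 2)
  have h3 := hσ (v, 3)
  have h4 := hσ (v, 4)
  have h5 := hσ (v, 5)
  simp [DArc8] at h0 h1 h2 h3 h4 h5
  refine ⟨?_, ?_, ?_, ?_, ?_, ?_⟩
  · exact Prod.ext h1.1.symm h1.2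
  · exact Prod.ext h3.1.symm h3.2
  · exact Prod.ext h4.1.symm h4.2
  · exact h2.2.imp (Prod.ext h2.1.symm) (Prod.ext h2.1.symm)
  · exact h5.2.imp (Prod.ext h5.1.symm) (Prod.ext h5.1.symm)
  · rcases h0 with h0 | h0
    · exact Or.inr ⟨_, h0.1, Prod.ext rfl h0.2⟩
    · exact Or.inl (Prod.ext h0.1.symm h0.2)

/-- In a factor of `D`, the gadget of `v` is covered either by two 3-cycles or by a 5-cycle avoiding
`v` itself. -/
theorem gadget_cases (hσ : ∀ x, DArc8 A x (σ x)) (v : V) :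
    (σ (v, 0) = (v, 1) ∧ σ (v, 2) = (v, 0) ∧ σ (v, 5) = (v, 3)) ∨
      ((∃ w, A v w ∧ σ (v, 0) = (w, 0)) ∧ σ (v, 2) = (v, 3) ∧ σ (v, 5) = (v, 1)) := by
  obtain ⟨-, -, -, h2, h5, h0⟩ := apply_of_dArc8 hσ v
  have ne (i j : Fin 6) (hij : i ≠ j) : σ (v, i) ≠ σ (v, j) := by simpa using hij
  have h25 := ne 2 5 (by decide)
  have h05 := ne 0 5 (by decide)
  rcases h0 with h0 | h0
  · left
    grind
  · right
    refine ⟨h0, ?_⟩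
    -- the predecessor of `(v, 1)` must be `(v, 5)`
    have h1 : σ (v, 5) = (v, 1) := by
      obtain ⟨⟨u, i⟩, hu⟩ := σ.surjective (v, 1)
      have h := hσ (u, i)
      rw [hu] at h
      fin_cases i <;> simp [DArc8] at h
      · obtain ⟨w, -, hw⟩ := h0
        subst h
        simp [hw] at hu
      · subst h
        exact hu
    obtain ⟨⟨u, i⟩, hu⟩ := σ.surjective (v, 3)
    have h := hσ (u, i)
    rw [hu] at h
    fin_cases i <;> simp [DArc8] at h
    · subst h
      exact ⟨hu, h1⟩
    · subst h
      simp [h1] at hu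

theorem not_even_minimalPeriod {α : Type*} {g : α → α} {x : α} {n : ℕ} (hn : Odd n)
    (h : Function.IsPeriodicPt g n x) : ¬ Even (Function.minimalPeriod g x) := fun he =>
  Nat.not_even_iff_odd.2 hn (even_iff_two_dvd.2 (he.two_dvd.trans h.minimalPeriod_dvd))

theorem snd_eq_zero_of_even_minimalPeriod (hσ : ∀ x, DArc8 A x (σ x)) {v : V} {i : Fin 6}
    (he : Even (Function.minimalPeriod σ (v, i))) :
    i = 0 ∧ ∃ w, A v w ∧ σ (v, 0) = (w, 0) := by
  obtain ⟨h1, h3, h4, -, -, -⟩ := apply_of_dArc8 hσ v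
  rcases gadget_cases hσ v with ⟨h0, h2, h5⟩ | ⟨h0, h2, h5⟩
  · refine absurd he (not_even_minimalPeriod (n := 3) (by decide) ?_)
    fin_cases i <;> simp [Function.IsPeriodicPt, Function.IsFixedPt, h0, h1, h2, h3, h4, h5]
  · refine ⟨?_, h0⟩
    by_contra hi
    refine absurd he (not_even_minimalPeriod (n := 5) (by decide) ?_)
    fin_cases i <;> simp [Function.IsPeriodicPt, Function.IsFixedPt, h1, h2, h3, h4, h5] at hi ⊢

theorem exists_even_dicycle_of_factor [Finite V] (hσ : ∀ x, DArc8 A x (σ x)) {x : V × Fin 6}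
    (he : Even (Function.minimalPeriod σ x)) :
    ∃ (m : ℕ) (f : Fin (2 * m + 1 + 1) → V),
        Function.Injective f ∧
        (∀ i : Fin (2 * m + 1), A (f i.castSucc) (f i.succ)) ∧
        A (f (Fin.last (2 * m + 1))) (f 0) := by
  have hx : x ∈ Function.periodicPts σ := σ.injective.mem_periodicPts x
  have hper (k : ℕ) : Function.minimalPeriod σ (σ^[k] x) = Function.minimalPeriod σ x :=
    Function.minimalPeriod_apply_iterate hx k
  have hz (k : ℕ) : (σ^[k] x).2 = 0 :=
    (snd_eq_zero_of_even_minimalPeriod hσ (v := (σ^[k] x).1) (i := (σ^[k] x).2)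
      (by simpa [hper k] using he)).1
  have harc (k : ℕ) : A (σ^[k] x).1 (σ^[k + 1] x).1 := by
    obtain ⟨w, hw, hσw⟩ := (snd_eq_zero_of_even_minimalPeriod hσ (v := (σ^[k] x).1)
      (i := (σ^[k] x).2) (by simpa [hper k] using he)).2
    have : σ^[k] x = ((σ^[k] x).1, 0) := Prod.ext rfl (hz k)
    rw [Function.iterate_succ_apply', this, hσw]
    exact hw
  have hpos := Function.minimalPeriod_pos_of_mem_periodicPts hx
  obtain ⟨m, hm⟩ : ∃ m, Function.minimalPeriod σ x = 2 * m + 1 + 1 := by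
    obtain ⟨r, hr⟩ := he
    exact ⟨r - 1, by omega⟩
  refine ⟨m, fun i => (σ^[i] x).1, fun i j hij => ?_, fun i => harc i, ?_⟩
  · have h : σ^[i] x = σ^[j] x := Prod.ext hij ((hz i).trans (hz j).symm)
    exact Fin.ext (Function.iterate_injOn_Iio_minimalPeriod (by simp only [Set.mem_Iio, hm, i.isLt])
      (by simp only [Set.mem_Iio, hm, j.isLt]) h)
  · have h := harc (2 * m + 1)
    rw [← hm, Function.iterate_minimalPeriod] at h
    exact h

end Factor

theorem exists_factor_of_even_dicycle {V : Type*} [Finite V] {A : V → V → Prop} {n : ℕ}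
    (hn : Even (n + 1)) {f : Fin (n + 1) → V} (hf : Function.Injective f)
    (hA : ∀ i, A (f i) (f (i + 1))) :
    ∃ σ : Equiv.Perm (V × Fin 6),
        (∀ x, DArc8 A x (σ x)) ∧ ∃ x, Even (Function.minimalPeriod σ x) := by
  let π : Equiv.Perm V := (finRotate (n + 1)).viaEmbedding ⟨f, hf⟩
  have hπ (i : Fin (n + 1)) : π (f i) = f (i + 1) := by
    simpa using (finRotate (n + 1)).viaEmbedding_apply ⟨f, hf⟩ i
  have hinj : Function.Injective (gadgetMap (Set.range f) π) := by
    refine gadgetMap_injective π.injective ?_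
    rintro _ ⟨i, rfl⟩
    exact ⟨i + 1, (hπ i).symm⟩
  have hiter (k : ℕ) :
      (gadgetMap (Set.range f) π)^[k] (f 0, 0) = (f (Fin.ofNat (n + 1) k), 0) := by
    induction k with
    | zero => simp
    | succ k ih =>
      have : Fin.ofNat (n + 1) k + 1 = Fin.ofNat (n + 1) (k + 1) := by
        ext
        simp [Fin.val_add]
      simp only [Function.iterate_succ_apply', ih, gadgetMap, Set.mem_range_self, if_true, hπ, this]
  refine ⟨Equiv.ofBijective _ (Finite.injective_iff_bijective.1 hinj),
    dArc8_gadgetMap ?_, (f 0, 0), ?_⟩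
  · rintro _ ⟨i, rfl⟩
    rw [hπ]
    exact hA i
  · rw [Equiv.coe_ofBijective]
    have h := Function.iterate_minimalPeriod (f := gadgetMap (Set.range f) π) (x := (f 0, 0))
    rw [hiter, Prod.mk.injEq] at h
    exact even_iff_two_dvd.2 (hn.two_dvd.trans (Nat.dvd_of_mod_eq_zero (congrArg Fin.val (hf h.1))))

/-- `D` admits a `(1,1)`-factor containing at least one even cycle iff `H` contains an
even directed cycle. -/
theorem existsEven_factor_iff_even_dicycle
    {V : Type*} [Fintype V] (A : V → V → Prop) (hA : Irreflexive A) :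
    (∃ σ : Equiv.Perm (V × Fin 6),
        (∀ x, DArc8 A x (σ x)) ∧
        ∃ x, Even (Function.minimalPeriod (⇑σ) x)) ↔
    (∃ (m : ℕ) (f : Fin (2 * m + 1 + 1) → V),
        Function.Injective f ∧
        (∀ i : Fin (2 * m + 1), A (f i.castSucc) (f i.succ)) ∧
        A (f (Fin.last (2 * m + 1))) (f 0)) := by
  constructor
  · rintro ⟨σ, hσ, x, he⟩
    exact exists_even_dicycle_of_factor hσ he
  · rintro ⟨m, f, hf, hstep, hlast⟩
    refine exists_factor_of_even_dicycle ⟨m + 1, by ring⟩ hf fun i => ?_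
    induction i using Fin.lastCases with
    | last => simpa using hlast
    | cast i => simpa using hstep i
end

section
/- Let D be a finite digraph. Let G be the simple graph whose vertex set consists of three vertices a_v, b_v, c_v for every vertex v of D, and whose edges are: {a_v, b_v} and {b_v, c_v} for every v ∈ V(D), and {c_u, a_v} for every arc (u,v) of D. Then for all natural numbers a and b: G has a 2-factor whose cycle decomposition consists of exactly a even cycles and exactly b odd cycles if and only if D has a (1,1)-factor whose cycles consist of exactly a even cycles and exactly b odd cycles. -/
/-- Edges of the auxiliary simple graph `G` on vertex set `V × Fin 3`, where for a
vertex `v` of `D` we encode `a_v = (v, 0)`, `b_v = (v, 1)`, `c_v = (v, 2)`: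
the edges `{a_v, b_v}` and `{b_v, c_v}` for every vertex `v` of `D`, and the edge
`{c_u, a_v}` for every arc `(u, v)` of `D`. -/
def GEdges9 {V : Type*} (A : V → V → Prop) : Set (Sym2 (V × Fin 3)) :=
  {e | (∃ v : V, e = s((v, 0), (v, 1)) ∨ e = s((v, 1), (v, 2))) ∨
       (∃ u v : V, A u v ∧ e = s((u, 2), (v, 0)))}

open Equiv.Perm in
/-- Two vertices of the graph built from a permutation `σ` are connected exactly when their
base points lie on the same cycle of `σ`. -/
theorem reachable_fromEdgeSet_GEdges9_iff_sameCycle {V : Type*} [Finite V] (σ : Equiv.Perm V)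
    (x y : V × Fin 3) :
    (SimpleGraph.fromEdgeSet (GEdges9 fun u v => σ u = v)).Reachable x y ↔
      σ.SameCycle x.1 y.1 := by
  set G := SimpleGraph.fromEdgeSet (GEdges9 fun u v => σ u = v) with hG
  constructor
  · rintro ⟨p⟩
    induction p with
    | nil => exact SameCycle.refl _ _
    | @cons u v w h p ih =>
      refine SameCycle.trans ?_ ih
      obtain ⟨u, i⟩ := u
      obtain ⟨v, j⟩ := v
      rw [hG, SimpleGraph.fromEdgeSet_adj] at h
      obtain ⟨⟨z, h | h⟩ | ⟨z, t, rfl, h⟩, -⟩ := h <;>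
        simp only [Sym2.eq_iff, Prod.mk.injEq] at h <;>
        obtain ⟨⟨rfl, -⟩, ⟨rfl, -⟩⟩ | ⟨⟨rfl, -⟩, ⟨rfl, -⟩⟩ := h <;> simp [SameCycle.refl]
  · have h01 (v : V) : G.Reachable (v, 0) (v, 1) := by
      refine SimpleGraph.Adj.reachable ?_
      rw [hG, SimpleGraph.fromEdgeSet_adj]
      exact ⟨Or.inl ⟨v, Or.inl rfl⟩, by simp⟩
    have h12 (v : V) : G.Reachable (v, 1) (v, 2) := by
      refine SimpleGraph.Adj.reachable ?_
      rw [hG, SimpleGraph.fromEdgeSet_adj]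
      exact ⟨Or.inl ⟨v, Or.inr rfl⟩, by simp⟩
    have h20 (v : V) : G.Reachable (v, 2) (σ v, 0) := by
      refine SimpleGraph.Adj.reachable ?_
      rw [hG, SimpleGraph.fromEdgeSet_adj]
      exact ⟨Or.inr ⟨v, σ v, rfl, rfl⟩, by simp⟩
    have h0 (v : V) (i : Fin 3) : G.Reachable (v, 0) (v, i) := by
      fin_cases i
      · exact SimpleGraph.Reachable.refl _
      · exact h01 v
      · exact (h01 v).trans (h12 v)
    have hpow (n : ℕ) (v : V) : G.Reachable (v, 0) ((σ ^ n) v, 0) := by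
      induction n with
      | zero => exact SimpleGraph.Reachable.refl _
      | succ n ih =>
        rw [pow_succ', Equiv.Perm.mul_apply]
        exact ih.trans ((h0 _ 2).trans (h20 _))
    intro h
    obtain ⟨n, hn⟩ := h.exists_nat_pow_eq
    have := hpow n x.1
    rw [hn] at this
    exact (h0 x.1 x.2).symm.trans (this.trans (h0 y.1 y.2))

open Equiv.Perm in
/-- For a fixed-point free permutation `σ`, the components of the graph built from `σ` whose order
satisfies `P` are counted by the cycles of `σ` whose tripled length satisfies `P`. -/
theorem card_connectedComponent_fromEdgeSet_GEdges9 {V : Type*} [Fintype V] [DecidableEq V]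
    (σ : Equiv.Perm V) (hσ : ∀ v, σ v ≠ v) (P : ℕ → Prop) [DecidablePred P] :
    Nat.card {C : (SimpleGraph.fromEdgeSet (GEdges9 fun u v => σ u = v)).ConnectedComponent //
        P (Nat.card C.supp)} =
      (σ.cycleFactorsFinset.filter fun c => P (3 * c.support.card)).card := by
  classical
  set G := SimpleGraph.fromEdgeSet (GEdges9 fun u v => σ u = v)
  let f : G.ConnectedComponent → Equiv.Perm V :=
    SimpleGraph.ConnectedComponent.lift (fun x => σ.cycleOf x.1) fun x y p _ =>
      ((reachable_fromEdgeSet_GEdges9_iff_sameCycle σ x y).1 ⟨p⟩).cycleOf_eq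
  have hf (x : V × Fin 3) : f (G.connectedComponentMk x) = σ.cycleOf x.1 := rfl
  have hsupp (x : V × Fin 3) :
      Nat.card (G.connectedComponentMk x).supp = 3 * (σ.cycleOf x.1).support.card := by
    have h : (G.connectedComponentMk x).supp =
        (((σ.cycleOf x.1).support ×ˢ Finset.univ : Finset (V × Fin 3)) : Set (V × Fin 3)) := by
      ext y
      rw [SimpleGraph.ConnectedComponent.mem_supp_iff, SimpleGraph.ConnectedComponent.eq,
        reachable_fromEdgeSet_GEdges9_iff_sameCycle, sameCycle_comm]
      simp only [Finset.coe_product, Finset.coe_univ, Set.mem_prod, Finset.mem_coe, Set.mem_univ,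
        and_true]
      rw [mem_support_cycleOf_iff, mem_support]
      exact ⟨fun h => ⟨h, hσ _⟩, fun h => h.1⟩
    rw [h, Nat.card_coe_set_eq, Set.ncard_coe_finset, Finset.card_product, mul_comm]
    simp
  have hinj : Function.Injective f := by
    intro C D
    induction C using SimpleGraph.ConnectedComponent.ind with | _ x
    induction D using SimpleGraph.ConnectedComponent.ind with | _ y
    intro h
    rw [hf, hf] at h
    rw [SimpleGraph.ConnectedComponent.eq, reachable_fromEdgeSet_GEdges9_iff_sameCycle]
    have hy : y.1 ∈ (σ.cycleOf y.1).support := by simp [hσ]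
    rw [← h, mem_support_cycleOf_iff] at hy
    exact hy.1
  rw [← Set.ncard_coe_finset]
  have himage : ((σ.cycleFactorsFinset.filter fun c => P (3 * c.support.card) :
      Finset (Equiv.Perm V)) : Set (Equiv.Perm V)) = f '' {C | P (Nat.card C.supp)} := by
    ext c
    simp only [Finset.coe_filter, Set.mem_ofPred_eq, Set.mem_image]
    constructor
    · rintro ⟨hc, hP⟩
      obtain ⟨v, hv⟩ := (mem_cycleFactorsFinset_iff.1 hc).1.nonempty_support
      have hcv := cycle_is_cycleOf hv hc
      exact ⟨G.connectedComponentMk (v, 0), by rw [hsupp, ← hcv]; exact hP, hcv.symm⟩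
    · rintro ⟨C, hC, rfl⟩
      induction C using SimpleGraph.ConnectedComponent.ind with | _ x
      rw [hsupp] at hC
      exact ⟨cycleOf_mem_cycleFactorsFinset_iff.2 (by simp [hσ]), hC⟩
  rw [himage, Set.ncard_image_of_injective _ hinj]
  exact Nat.card_coe_set_eq _

/-- The edge set built from a permutation is 2-regular. -/
theorem card_filter_mem_GEdges9_perm {V : Type*} [DecidableEq V] (σ : Equiv.Perm V)
    (F : Finset (Sym2 (V × Fin 3)))
    (hF : (F : Set (Sym2 (V × Fin 3))) = GEdges9 fun u v => σ u = v) (x : V × Fin 3) :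
    (F.filter fun e => x ∈ e).card = 2 := by
  have hmem (e) : e ∈ F ↔ e ∈ GEdges9 fun u v => σ u = v := by rw [← hF, Finset.mem_coe]
  obtain ⟨v, i⟩ := x
  rw [Finset.card_eq_two]
  fin_cases i
  · refine ⟨s((v, 0), (v, 1)), s((σ.symm v, 2), (v, 0)), by simp, ?_⟩
    ext e
    simp only [Finset.mem_filter, hmem, GEdges9, Set.mem_ofPred_eq, Finset.mem_insert,
      Finset.mem_singleton]
    constructor
    · rintro ⟨⟨z, rfl | rfl⟩ | ⟨z, t, rfl, rfl⟩, h⟩ <;> simp at h <;> simp [h]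
    · rintro (rfl | rfl)
      · exact ⟨Or.inl ⟨v, Or.inl rfl⟩, by simp⟩
      · exact ⟨Or.inr ⟨σ.symm v, v, by simp, rfl⟩, by simp⟩
  · refine ⟨s((v, 0), (v, 1)), s((v, 1), (v, 2)), by simp, ?_⟩
    ext e
    simp only [Finset.mem_filter, hmem, GEdges9, Set.mem_ofPred_eq, Finset.mem_insert,
      Finset.mem_singleton]
    constructor
    · rintro ⟨⟨z, rfl | rfl⟩ | ⟨z, t, rfl, rfl⟩, h⟩ <;> simp at h <;> simp [h]
    · rintro (rfl | rfl)
      · exact ⟨Or.inl ⟨v, Or.inl rfl⟩, by simp⟩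
      · exact ⟨Or.inl ⟨v, Or.inr rfl⟩, by simp⟩
  · refine ⟨s((v, 1), (v, 2)), s((v, 2), (σ v, 0)), by simp, ?_⟩
    ext e
    simp only [Finset.mem_filter, hmem, GEdges9, Set.mem_ofPred_eq, Finset.mem_insert,
      Finset.mem_singleton]
    constructor
    · rintro ⟨⟨z, rfl | rfl⟩ | ⟨z, t, rfl, rfl⟩, h⟩ <;> simp at h <;> simp [h]
    · rintro (rfl | rfl)
      · exact ⟨Or.inl ⟨v, Or.inr rfl⟩, by simp⟩
      · exact ⟨Or.inr ⟨v, σ v, rfl, rfl⟩, by simp⟩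

/-- Every 2-regular set of edges of the auxiliary graph comes from a permutation along arcs. -/
theorem exists_perm_coe_eq_GEdges9 {V : Type*} [Finite V] [DecidableEq V] {A : V → V → Prop}
    {F : Finset (Sym2 (V × Fin 3))} (hFA : (F : Set (Sym2 (V × Fin 3))) ⊆ GEdges9 A)
    (hF : ∀ x : V × Fin 3, (F.filter fun e => x ∈ e).card = 2) :
    ∃ σ : Equiv.Perm V, (∀ v, A v (σ v)) ∧
      (F : Set (Sym2 (V × Fin 3))) = GEdges9 fun u v => σ u = v := by
  have hmiddle (v : V) : s((v, 0), (v, 1)) ∈ F ∧ s((v, 1), (v, 2)) ∈ F := by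
    have hsub : (F.filter fun e => (v, (1 : Fin 3)) ∈ e) ⊆
        {s((v, 0), (v, 1)), s((v, 1), (v, 2))} := by
      intro e he
      rw [Finset.mem_filter] at he
      obtain ⟨he, h⟩ := he
      obtain ⟨z, rfl | rfl⟩ | ⟨z, t, -, rfl⟩ := hFA he <;> simp at h <;> simp [h]
    have heq := Finset.eq_of_subset_of_card_le hsub (by rw [hF]; exact Finset.card_le_two)
    constructor
    · exact (Finset.mem_filter.1 (heq.symm ▸ by simp :
        s((v, 0), (v, 1)) ∈ F.filter fun e => (v, (1 : Fin 3)) ∈ e)).1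
    · exact (Finset.mem_filter.1 (heq.symm ▸ by simp :
        s((v, 1), (v, 2)) ∈ F.filter fun e => (v, (1 : Fin 3)) ∈ e)).1
  have hout (v : V) : ∃ w, s((v, 2), (w, 0)) ∈ F := by
    have hcard : 1 < (F.filter fun e => (v, (2 : Fin 3)) ∈ e).card := by rw [hF]; norm_num
    obtain ⟨e, he, hne⟩ := Finset.exists_mem_ne hcard s((v, 1), (v, 2))
    rw [Finset.mem_filter] at he
    obtain ⟨he, h⟩ := he
    obtain ⟨z, rfl | rfl⟩ | ⟨z, t, -, rfl⟩ := hFA he <;> simp at h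
    · exact absurd (by rw [h]) hne
    · exact ⟨t, by rwa [h]⟩
  have honly {x : V × Fin 3} {e₁ e₂ e₃ : Sym2 (V × Fin 3)} (h₁ : e₁ ∈ F) (h₂ : e₂ ∈ F)
      (h₃ : e₃ ∈ F) (hx₁ : x ∈ e₁) (hx₂ : x ∈ e₂) (hx₃ : x ∈ e₃) (h₁₂ : e₁ ≠ e₂)
      (h₁₃ : e₁ ≠ e₃) : e₂ = e₃ := by
    by_contra h₂₃
    have : ({e₁, e₂, e₃} : Finset _) ⊆ F.filter fun e => x ∈ e := by
      intro e he
      simp only [Finset.mem_insert, Finset.mem_singleton] at he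
      rw [Finset.mem_filter]
      rcases he with rfl | rfl | rfl <;> exact ⟨by assumption, by assumption⟩
    have := Finset.card_le_card this
    rw [hF, Finset.card_eq_three.2 ⟨e₁, e₂, e₃, h₁₂, h₁₃, h₂₃, rfl⟩] at this
    omega
  choose f hf using hout
  have hunique {v w : V} (h : s((v, 2), (w, 0)) ∈ F) : f v = w := by
    have := honly (x := (v, 2)) (hmiddle v).2 (hf v) h (by simp) (by simp) (by simp) (by simp)
      (by simp)
    simpa using this
  have hinj : Function.Injective f := by
    intro u v huv
    have hu := hf u
    rw [huv] at hu
    have := honly (x := (f v, 0)) (hmiddle (f v)).1 hu (hf v) (by simp) (by simp) (by simp)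
      (by simp) (by simp)
    simpa using this
  refine ⟨Equiv.ofBijective f (Finite.injective_iff_bijective.1 hinj), fun v => ?_, ?_⟩
  · rw [Equiv.ofBijective_apply]
    obtain ⟨z, h | h⟩ | ⟨z, t, hA, h⟩ := hFA (hf v) <;> simp at h
    obtain ⟨rfl, rfl⟩ := h
    exact hA
  · ext e
    rw [Finset.mem_coe]
    constructor
    · intro he
      obtain h | ⟨z, t, -, rfl⟩ := hFA he
      · exact Or.inl h
      · exact Or.inr ⟨z, t, hunique he, rfl⟩
    · rintro (⟨z, rfl | rfl⟩ | ⟨z, t, rfl, rfl⟩)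
      · exact (hmiddle z).1
      · exact (hmiddle z).2
      · exact hf z

/-- For all natural numbers `a, b`: the graph `G` has a 2-factor whose cycle
decomposition consists of exactly `a` even cycles and `b` odd cycles iff the digraph
`D` has a `(1,1)`-factor whose cycles consist of exactly `a` even cycles and `b` odd
cycles.  The cycles of a 2-factor `F` are the connected components of the spanning
subgraph induced by `F`, with length the number of their vertices; the cycles of a
`(1,1)`-factor `σ` are the cycles of the permutation `σ`. -/
theorem two_factor_parity_count_iff_factor_parity_count
    {V : Type*} [Fintype V] [DecidableEq V]
    (A : V → V → Prop) (hA : Irreflexive A) (a b : ℕ) :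
    (∃ F : Finset (Sym2 (V × Fin 3)),
        (↑F : Set (Sym2 (V × Fin 3))) ⊆ GEdges9 A ∧
        (∀ x : V × Fin 3, (F.filter (fun e => x ∈ e)).card = 2) ∧
        Nat.card {C : (SimpleGraph.fromEdgeSet
            (↑F : Set (Sym2 (V × Fin 3)))).ConnectedComponent //
          Even (Nat.card C.supp)} = a ∧
        Nat.card {C : (SimpleGraph.fromEdgeSet
            (↑F : Set (Sym2 (V × Fin 3)))).ConnectedComponent //
          Odd (Nat.card C.supp)} = b) ↔
    (∃ σ : Equiv.Perm V, (∀ v, A v (σ v)) ∧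
        (σ.cycleFactorsFinset.filter (fun c => Even c.support.card)).card = a ∧
        (σ.cycleFactorsFinset.filter (fun c => Odd c.support.card)).card = b) := by
  classical
  have hcount (σ : Equiv.Perm V) (hσ : ∀ v, A v (σ v)) :
      Nat.card {C : (SimpleGraph.fromEdgeSet (GEdges9 fun u v => σ u = v)).ConnectedComponent //
          Even (Nat.card C.supp)} =
        (σ.cycleFactorsFinset.filter (fun c => Even c.support.card)).card ∧
      Nat.card {C : (SimpleGraph.fromEdgeSet (GEdges9 fun u v => σ u = v)).ConnectedComponent //
          Odd (Nat.card C.supp)} =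
        (σ.cycleFactorsFinset.filter (fun c => Odd c.support.card)).card := by
    have hne (v : V) : σ v ≠ v := fun h => hA v (by simpa [h] using hσ v)
    have h3 : ¬Even 3 := by decide
    have h3' : Odd 3 := by decide
    rw [card_connectedComponent_fromEdgeSet_GEdges9 σ hne Even,
      card_connectedComponent_fromEdgeSet_GEdges9 σ hne Odd]
    simp only [Nat.even_mul, Nat.odd_mul, h3, h3', false_or, true_and, and_self]
  constructor
  · rintro ⟨F, hFA, hF, ha, hb⟩
    obtain ⟨σ, hσ, hFσ⟩ := exists_perm_coe_eq_GEdges9 hFA hF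
    rw [hFσ] at ha hb
    exact ⟨σ, hσ, (hcount σ hσ).1 ▸ ha, (hcount σ hσ).2 ▸ hb⟩
  · rintro ⟨σ, hσ, ha, hb⟩
    obtain ⟨F, hF⟩ := (Set.toFinite (GEdges9 fun u v => σ u = v)).exists_finset_coe
    refine ⟨F, ?_, card_filter_mem_GEdges9_perm σ F hF, ?_, ?_⟩
    · rw [hF]
      rintro e (h | ⟨u, v, rfl, h⟩)
      · exact Or.inl h
      · exact Or.inr ⟨u, σ u, hσ u, h⟩
    · rw [hF, (hcount σ hσ).1, ha]
    · rw [hF, (hcount σ hσ).2, hb]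
end

section
/- Let X, Y, Z be pairwise disjoint finite sets with |X| = |Y| = |Z| and let T ⊆ X × Y × Z. Consider the multigraph H on vertex set X ∪ Y ∪ Z whose edges are indexed by the pairs (t, i) ∈ T × {1,2,3}, where for t = (x, y, z) the edge (t,1) has endpoints x and y, the edge (t,2) has endpoints y and z, and the edge (t,3) has endpoints z and x. Let P be the collection of all 2-element sets {(t1, i), (t2, j)} of such edges with t1 ≠ t2 whose corresponding edges share at least one endpoint. Then T contains a perfect matching M (i.e., M ⊆ T such that every element of X ∪ Y ∪ Z occurs in exactly one tuple of M) if and only if there exists F ⊆ T × {1,2,3} such that every vertex of X ∪ Y ∪ Z is an endpoint of exactly two edges of F and |F ∩ p| ≤ 1 for every p ∈ P. -/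
/-- The endpoints of the edge `(t, i)` of the multigraph `H` built from a triple
`t = (x, y, z)`: edge `(t, 0)` joins `x` and `y`, edge `(t, 1)` joins `y` and `z`,
and edge `(t, 2)` joins `z` and `x`. -/
def tripleEdge {α : Type*} : (α × α × α) × Fin 3 → Sym2 α := fun e =>
  if e.2 = 0 then s(e.1.1, e.1.2.1)
  else if e.2 = 1 then s(e.1.2.1, e.1.2.2)
  else s(e.1.2.2, e.1.1)

theorem mem_tripleEdge {α : Type*} {v : α} {e : (α × α × α) × Fin 3}
    (h : v ∈ tripleEdge e) : v = e.1.1 ∨ v = e.1.2.1 ∨ v = e.1.2.2 := by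
  unfold tripleEdge at h
  split_ifs at h <;> rw [Sym2.mem_iff] at h <;> tauto

/-- Each vertex of a triangle with distinct corners lies on exactly two of its edges. -/
theorem card_filter_mem_tripleEdge {α : Type*} [DecidableEq α] {t : α × α × α} {v : α}
    (h₁ : t.1 ≠ t.2.1) (h₂ : t.2.1 ≠ t.2.2) (h₃ : t.1 ≠ t.2.2)
    (hv : v = t.1 ∨ v = t.2.1 ∨ v = t.2.2) :
    ((({t} : Finset (α × α × α)) ×ˢ (Finset.univ : Finset (Fin 3))).filter
      (fun e => v ∈ tripleEdge e)).card = 2 := by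
  rw [Finset.singleton_product, Finset.filter_map, Finset.card_map, Finset.card_filter,
    Fin.sum_univ_three]
  rcases hv with rfl | rfl | rfl <;>
    simp [tripleEdge, h₁, h₂, h₃, h₁.symm, h₂.symm, h₃.symm]

/-- If the edges of `F` at `v` all come from the triple `t` and there are two of them, then
`F` contains every edge of `t` at `v`. -/
theorem mem_of_mem_tripleEdge {α : Type*} [DecidableEq α] {t : α × α × α} {v : α}
    {F : Finset ((α × α × α) × Fin 3)}
    (h₁ : t.1 ≠ t.2.1) (h₂ : t.2.1 ≠ t.2.2) (h₃ : t.1 ≠ t.2.2)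
    (hF : ∀ e ∈ F, v ∈ tripleEdge e → e.1 = t)
    (hcard : (F.filter (fun e => v ∈ tripleEdge e)).card = 2)
    {i : Fin 3} (hi : v ∈ tripleEdge (t, i)) : (t, i) ∈ F := by
  have hsub : F.filter (fun e => v ∈ tripleEdge e) ⊆
      (({t} : Finset (α × α × α)) ×ˢ (Finset.univ : Finset (Fin 3))).filter
        (fun e => v ∈ tripleEdge e) := by
    intro e he
    rw [Finset.mem_filter] at he ⊢
    exact ⟨Finset.mem_product.mpr ⟨Finset.mem_singleton.mpr (hF e he.1 he.2),
      Finset.mem_univ _⟩, he.2⟩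
  have heq := Finset.eq_of_subset_of_card_le hsub
    (by rw [hcard, card_filter_mem_tripleEdge h₁ h₂ h₃ (mem_tripleEdge hi)])
  have hmem : (t, i) ∈ F.filter (fun e => v ∈ tripleEdge e) := by
    rw [heq]
    simpa using hi
  exact (Finset.mem_filter.mp hmem).1

/-- `T` contains a perfect matching of `X ∪ Y ∪ Z` iff there is a set `F` of edges of
the multigraph `H` (indexed by `T × Fin 3`) such that every vertex of `X ∪ Y ∪ Z` is an
endpoint of exactly two edges of `F`, and `F` never contains two edges coming from
distinct triples that share an endpoint (i.e. `F` is `P`-respecting). -/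
theorem threeDM_iff_pair_restricted_two_factor
    {α : Type*} [DecidableEq α] (X Y Z : Finset α)
    (hXY : Disjoint X Y) (hYZ : Disjoint Y Z) (hXZ : Disjoint X Z)
    (hXYcard : X.card = Y.card) (hYZcard : Y.card = Z.card)
    (T : Finset (α × α × α)) (hT : ∀ t ∈ T, t.1 ∈ X ∧ t.2.1 ∈ Y ∧ t.2.2 ∈ Z) :
    (∃ M ⊆ T, ∀ v ∈ X ∪ Y ∪ Z,
        (M.filter (fun t => v = t.1 ∨ v = t.2.1 ∨ v = t.2.2)).card = 1) ↔
    (∃ F : Finset ((α × α × α) × Fin 3),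
        F ⊆ T ×ˢ Finset.univ ∧
        (∀ v ∈ X ∪ Y ∪ Z, (F.filter (fun e => v ∈ tripleEdge e)).card = 2) ∧
        (∀ e₁ ∈ F, ∀ e₂ ∈ F, e₁.1 ≠ e₂.1 →
          ∀ v, ¬(v ∈ tripleEdge e₁ ∧ v ∈ tripleEdge e₂))) := by
  have hne : ∀ t ∈ T, t.1 ≠ t.2.1 ∧ t.2.1 ≠ t.2.2 ∧ t.1 ≠ t.2.2 := fun t ht =>
    ⟨Finset.disjoint_iff_ne.mp hXY _ (hT t ht).1 _ (hT t ht).2.1,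
      Finset.disjoint_iff_ne.mp hYZ _ (hT t ht).2.1 _ (hT t ht).2.2,
      Finset.disjoint_iff_ne.mp hXZ _ (hT t ht).1 _ (hT t ht).2.2⟩
  have hvert : ∀ t ∈ T, ∀ v, v = t.1 ∨ v = t.2.1 ∨ v = t.2.2 → v ∈ X ∪ Y ∪ Z := by
    intro t ht v hv
    obtain ⟨hx, hy, hz⟩ := hT t ht
    rcases hv with rfl | rfl | rfl <;> simp [hx, hy, hz]
  constructor
  · rintro ⟨M, hMT, hM⟩
    have huniq : ∀ t ∈ M, ∀ t' ∈ M, ∀ v, (v = t.1 ∨ v = t.2.1 ∨ v = t.2.2) →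
        (v = t'.1 ∨ v = t'.2.1 ∨ v = t'.2.2) → t = t' := fun t ht t' ht' v hv hv' =>
      Finset.card_le_one.mp (hM v (hvert t (hMT ht) v hv)).le t
        (Finset.mem_filter.mpr ⟨ht, hv⟩) t' (Finset.mem_filter.mpr ⟨ht', hv'⟩)
    refine ⟨M ×ˢ Finset.univ, Finset.product_subset_product_left hMT, ?_, ?_⟩
    · intro v hv
      obtain ⟨t, ht⟩ := Finset.card_pos.mp (by rw [hM v hv]; exact one_pos)
      obtain ⟨htM, htv⟩ := Finset.mem_filter.mp ht
      obtain ⟨h₁, h₂, h₃⟩ := hne t (hMT htM)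
      rw [← card_filter_mem_tripleEdge h₁ h₂ h₃ htv]
      congr 1
      ext e
      simp only [Finset.mem_filter, Finset.mem_product, Finset.mem_univ, and_true,
        Finset.mem_singleton]
      exact ⟨fun h => ⟨huniq _ h.1 _ htM v (mem_tripleEdge h.2) htv, h.2⟩,
        fun h => ⟨h.1 ▸ htM, h.2⟩⟩
    · rintro e₁ he₁ e₂ he₂ hne' v ⟨hv₁, hv₂⟩
      exact hne' (huniq _ (Finset.mem_product.mp he₁).1 _ (Finset.mem_product.mp he₂).1 v
        (mem_tripleEdge hv₁) (mem_tripleEdge hv₂))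
  · rintro ⟨F, hFT, hF, hP⟩
    have hT' : ∀ e ∈ F, e.1 ∈ T := fun e he => (Finset.mem_product.mp (hFT he)).1
    have hstep : ∀ t i j v, (t, i) ∈ F → v ∈ tripleEdge (t, i) → v ∈ tripleEdge (t, j) →
        (t, j) ∈ F := by
      intro t i j v hi hvi hvj
      obtain ⟨h₁, h₂, h₃⟩ := hne t (hT' _ hi)
      refine mem_of_mem_tripleEdge h₁ h₂ h₃ (fun e he hve => ?_)
        (hF v (hvert t (hT' _ hi) v (mem_tripleEdge hvi))) hvj
      by_contra hcon
      exact hP e he (t, i) hi hcon v ⟨hve, hvi⟩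
    have hall : ∀ t i j, (t, i) ∈ F → (t, j) ∈ F := by
      intro t i j hi
      have hshare : ∃ v, v ∈ tripleEdge (t, i) ∧ v ∈ tripleEdge (t, j) := by
        fin_cases i <;> fin_cases j <;>
          first
          | (refine ⟨t.1, ?_, ?_⟩ <;> simp [tripleEdge]; done)
          | (refine ⟨t.2.1, ?_, ?_⟩ <;> simp [tripleEdge]; done)
          | refine ⟨t.2.2, ?_, ?_⟩ <;> simp [tripleEdge]
      obtain ⟨v, hvi, hvj⟩ := hshare
      exact hstep t i j v hi hvi hvj
    have hcov : ∀ t ∈ F.image Prod.fst, ∀ v, (v = t.1 ∨ v = t.2.1 ∨ v = t.2.2) →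
        ∃ i, (t, i) ∈ F ∧ v ∈ tripleEdge (t, i) := by
      intro t ht v hv
      obtain ⟨⟨_, k⟩, he, rfl⟩ := Finset.mem_image.mp ht
      rcases hv with rfl | rfl | rfl
      · exact ⟨0, hall _ k 0 he, by simp [tripleEdge]⟩
      · exact ⟨1, hall _ k 1 he, by simp [tripleEdge]⟩
      · exact ⟨2, hall _ k 2 he, by simp [tripleEdge]⟩
    refine ⟨F.image Prod.fst, Finset.image_subset_iff.mpr hT', fun v hv => ?_⟩
    obtain ⟨e, he⟩ := Finset.card_pos.mp (by rw [hF v hv]; exact two_pos)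
    obtain ⟨heF, hev⟩ := Finset.mem_filter.mp he
    refine le_antisymm (Finset.card_le_one.mpr fun t ht t' ht' => ?_)
      (Finset.card_pos.mpr ⟨e.1, Finset.mem_filter.mpr
        ⟨Finset.mem_image_of_mem _ heF, mem_tripleEdge hev⟩⟩)
    obtain ⟨htM, htv⟩ := Finset.mem_filter.mp ht
    obtain ⟨htM', htv'⟩ := Finset.mem_filter.mp ht'
    obtain ⟨i, hi, hvi⟩ := hcov t htM v htv
    obtain ⟨j, hj, hvj⟩ := hcov t' htM' v htv'
    by_contra hcon
    exact hP _ hi _ hj hcon v ⟨hvi, hvj⟩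
end

section
/- Let X, Y, Z be pairwise disjoint finite sets with |X| = |Y| = |Z| and let T ⊆ X × Y × Z. Consider the multigraph H on vertex set X ∪ Y ∪ Z whose edges are indexed by the pairs (t, i) ∈ T × {1,2,3}, where for t = (x, y, z) the edge (t,1) has endpoints x and y, the edge (t,2) has endpoints y and z, and the edge (t,3) has endpoints z and x; let P be the collection of all 2-element sets {(t1, i), (t2, j)} of such edges with t1 ≠ t2 whose corresponding edges share at least one endpoint. If F ⊆ T × {1,2,3} is such that every vertex of X ∪ Y ∪ Z is an endpoint of exactly two edges of F and |F ∩ p| ≤ 1 for every p ∈ P, then there exists M ⊆ T with F = M × {1,2,3}, and this M is a perfect matching of T (every element of X ∪ Y ∪ Z occurs in exactly one tuple of M). -/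
theorem exists_mem_tripleEdge_iff {α : Type*} (t : α × α × α) (v : α) :
    (∃ i, v ∈ tripleEdge (t, i)) ↔ v = t.1 ∨ v = t.2.1 ∨ v = t.2.2 := by
  simp only [Fin.exists_fin_succ, tripleEdge]
  simp
  tauto

/-- If `F` is a set of edges of the multigraph `H` (indexed by `T × Fin 3`) such that
every vertex of `X ∪ Y ∪ Z` is an endpoint of exactly two edges of `F` and `F` never
contains two edges coming from distinct triples sharing an endpoint (`P`-respecting),
then `F = M × Fin 3` for some `M ⊆ T`, and `M` is a perfect matching of `T`. -/
theorem pair_restricted_two_factor_is_matching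
    {α : Type*} [DecidableEq α] (X Y Z : Finset α)
    (hXY : Disjoint X Y) (hYZ : Disjoint Y Z) (hXZ : Disjoint X Z)
    (hXYcard : X.card = Y.card) (hYZcard : Y.card = Z.card)
    (T : Finset (α × α × α)) (hT : ∀ t ∈ T, t.1 ∈ X ∧ t.2.1 ∈ Y ∧ t.2.2 ∈ Z)
    (F : Finset ((α × α × α) × Fin 3))
    (hFT : F ⊆ T ×ˢ Finset.univ)
    (hdeg : ∀ v ∈ X ∪ Y ∪ Z, (F.filter (fun e => v ∈ tripleEdge e)).card = 2)
    (hresp : ∀ e₁ ∈ F, ∀ e₂ ∈ F, e₁.1 ≠ e₂.1 →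
      ∀ v, ¬(v ∈ tripleEdge e₁ ∧ v ∈ tripleEdge e₂)) :
    ∃ M ⊆ T, F = M ×ˢ Finset.univ ∧
      ∀ v ∈ X ∪ Y ∪ Z,
        (M.filter (fun t => v = t.1 ∨ v = t.2.1 ∨ v = t.2.2)).card = 1 := by
  classical
  have partner : ∀ t i v, (t, i) ∈ F → v ∈ X ∪ Y ∪ Z → v ∈ tripleEdge (t, i) →
      ∃ j, j ≠ i ∧ (t, j) ∈ F ∧ v ∈ tripleEdge (t, j) := by
    intro t i v hF hv hvi
    obtain ⟨⟨t', j⟩, hj, hne⟩ := Finset.exists_mem_ne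
      (by rw [hdeg v hv]; exact one_lt_two) (t, i)
    rw [Finset.mem_filter] at hj
    obtain rfl : t' = t := by
      by_contra h
      exact hresp _ hj.1 _ hF h v ⟨hj.2, hvi⟩
    exact ⟨j, fun h => hne (by rw [h]), hj⟩
  have memT : ∀ {e}, e ∈ F → e.1 ∈ T := fun he => (Finset.mem_product.1 (hFT he)).1
  have next : ∀ t i, (t, i) ∈ F → (t, i + 1) ∈ F := by
    rintro ⟨x, y, z⟩ i hF
    obtain ⟨hx, hy, hz⟩ := hT _ (memT hF)
    dsimp only at hx hy hz
    have hxy : x ≠ y := fun h => Finset.disjoint_left.1 hXY hx (h ▸ hy)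
    have hyz : y ≠ z := fun h => Finset.disjoint_left.1 hYZ hy (h ▸ hz)
    have hxz : x ≠ z := fun h => Finset.disjoint_left.1 hXZ hx (h ▸ hz)
    fin_cases i
    · obtain ⟨j, hj, hjF, hv⟩ := partner _ _ y hF (by simp [hy]) (by simp [tripleEdge])
      fin_cases j
      · exact absurd rfl hj
      · exact hjF
      · simp [tripleEdge, hxy.symm, hyz] at hv
    · obtain ⟨j, hj, hjF, hv⟩ := partner _ _ z hF (by simp [hz]) (by simp [tripleEdge])
      fin_cases j
      · simp [tripleEdge, hyz.symm, hxz.symm] at hv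
      · exact absurd rfl hj
      · exact hjF
    · obtain ⟨j, hj, hjF, hv⟩ := partner _ _ x hF (by simp [hx]) (by simp [tripleEdge])
      fin_cases j
      · exact hjF
      · simp [tripleEdge, hxy, hxz] at hv
      · exact absurd rfl hj
  have full : ∀ t i j, (t, i) ∈ F → (t, j) ∈ F := by
    intro t i j h
    have h₁ := next _ _ h
    have h₂ := next _ _ h₁
    have cover : ∀ i j : Fin 3, j = i ∨ j = i + 1 ∨ j = i + 1 + 1 := by decide
    rcases cover i j with rfl | rfl | rfl <;> assumption
  refine ⟨F.image Prod.fst, Finset.image_subset_iff.2 fun _ he => memT he, ?_, ?_⟩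
  · ext ⟨t, j⟩
    simp only [Finset.mem_product, Finset.mem_image, Finset.mem_univ, and_true]
    constructor
    · exact fun h => ⟨_, h, rfl⟩
    · rintro ⟨⟨t, i⟩, h, rfl⟩
      exact full t i j h
  · intro v hv
    obtain ⟨⟨t, i⟩, he⟩ := Finset.card_pos.1 (by rw [hdeg v hv]; exact two_pos)
    rw [Finset.mem_filter] at he
    refine Finset.card_eq_one.2 ⟨t, Finset.eq_singleton_iff_unique_mem.2 ⟨?_, ?_⟩⟩
    · exact Finset.mem_filter.2
        ⟨Finset.mem_image_of_mem _ he.1, (exists_mem_tripleEdge_iff t v).1 ⟨i, he.2⟩⟩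
    · intro t' ht'
      obtain ⟨hM, hvt'⟩ := Finset.mem_filter.1 ht'
      obtain ⟨⟨t', k⟩, hk, rfl⟩ := Finset.mem_image.1 hM
      obtain ⟨j, hj⟩ := (exists_mem_tripleEdge_iff t' v).2 hvt'
      by_contra h
      exact hresp _ (full t' k j hk) _ he.1 h v ⟨hj, he.2⟩
end

section
/- Let H be a finite simple graph with a fixed enumeration e_1, ..., e_m of its edge set, let P be a collection of 2-element subsets of E(H), and let G and Z be constructed as follows: the vertex set of G consists of V(H), a vertex w_{e,f} for every ordered pair (e,f) of edges of H, and vertices z_{e,f}, z_{f,e} for every {e,f} ∈ P; for every edge e = v_i v_j of H with i < j, G contains the set S_e of m+1 undirected edges forming the path v_i, w_{e,e_1}, ..., w_{e,e_m}, v_j; for every {e,f} ∈ P, G contains the undirected edge z_{e,f} z_{f,e} and the four arcs (w_{e,f}, z_{e,f}), (z_{f,e}, w_{e,f}), (w_{f,e}, z_{f,e}), (z_{e,f}, w_{f,e}); and Z is the set of all vertices z_{e,f}, z_{f,e}. Let σ (a fixed-point-free permutation of a vertex subset W ⊇ Z) be a Z-mixed cycle-factor of G, and say that an undirected edge {u,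 v} of G is used by σ if u, v ∈ W and σ(u) = v or σ(v) = u. Then for every edge e of H, either every edge of S_e is used by σ, or no edge of S_e is used by σ. -/
/-- Vertices of the mixed graph `G` built from a graph `H` with `m` enumerated edges
(edge `k` having oriented endpoints `(ends k).1`, `(ends k).2`) and a collection `P`
of 2-element subsets of the edge set: the vertices of `H`, a vertex `w_{e,f}`
(encoded `Sum.inr (Sum.inl (e, f))`) for every ordered pair of edges, and vertices
`z_{e,f}` (encoded `Sum.inr (Sum.inr ⟨(e, f), _⟩)`) for every `{e, f} ∈ P`. -/
abbrev GVert (V : Type*) (m : ℕ) (P : Set (Sym2 (Fin m))) : Type _ :=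
  V ⊕ (Fin m × Fin m) ⊕ {p : Fin m × Fin m // s(p.1, p.2) ∈ P}

/-- The `m + 1` undirected edges of the path
`v_i, w_{e,e_1}, w_{e,e_2}, …, w_{e,e_m}, v_j` associated to the edge `e = k` of `H`
with `e = v_i v_j`, `i < j` (so `(ends k).1 = v_i`, `(ends k).2 = v_j`). -/
def SEdge {V : Type*} {m : ℕ} (P : Set (Sym2 (Fin m))) (ends : Fin m → V × V)
    (k : Fin m) : GVert V m P → GVert V m P → Prop := fun x y =>
  (x = Sum.inl (ends k).1 ∧
    y = Sum.inr (Sum.inl (k, ⟨0, Nat.lt_of_le_of_lt (Nat.zero_le _) k.isLt⟩))) ∨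
  (∃ l l' : Fin m, (l : ℕ) + 1 = (l' : ℕ) ∧
    x = Sum.inr (Sum.inl (k, l)) ∧ y = Sum.inr (Sum.inl (k, l'))) ∨
  (x = Sum.inr (Sum.inl (k,
      ⟨m - 1, Nat.sub_lt (Nat.lt_of_le_of_lt (Nat.zero_le _) k.isLt) Nat.one_pos⟩)) ∧
    y = Sum.inl (ends k).2)

/-- Undirected edges of `G`: the paths `S_e` for all edges `e` of `H`
(symmetrized), together with the edge `z_{e,f} z_{f,e}` for every `{e, f} ∈ P`. -/
def GEdge {V : Type*} {m : ℕ} (P : Set (Sym2 (Fin m))) (ends : Fin m → V × V) :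
    GVert V m P → GVert V m P → Prop := fun x y =>
  (∃ k : Fin m, SEdge P ends k x y ∨ SEdge P ends k y x) ∨
  (∃ (e f : Fin m) (he : s(e, f) ∈ P) (hf : s(f, e) ∈ P),
    (x = Sum.inr (Sum.inr ⟨(e, f), he⟩) ∧ y = Sum.inr (Sum.inr ⟨(f, e), hf⟩)) ∨
    (x = Sum.inr (Sum.inr ⟨(f, e), hf⟩) ∧ y = Sum.inr (Sum.inr ⟨(e, f), he⟩)))

/-- Arcs of `G`: for every `{e, f} ∈ P`, the four arcs `(w_{e,f}, z_{e,f})`,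
`(z_{f,e}, w_{e,f})`, `(w_{f,e}, z_{f,e})`, `(z_{e,f}, w_{f,e})`. -/
def GArc {V : Type*} {m : ℕ} (P : Set (Sym2 (Fin m))) :
    GVert V m P → GVert V m P → Prop := fun x y =>
  ∃ (e f : Fin m) (he : s(e, f) ∈ P) (hf : s(f, e) ∈ P),
    (x = Sum.inr (Sum.inl (e, f)) ∧ y = Sum.inr (Sum.inr ⟨(e, f), he⟩)) ∨
    (x = Sum.inr (Sum.inr ⟨(f, e), hf⟩) ∧ y = Sum.inr (Sum.inl (e, f))) ∨
    (x = Sum.inr (Sum.inl (f, e)) ∧ y = Sum.inr (Sum.inr ⟨(f, e), hf⟩)) ∨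
    (x = Sum.inr (Sum.inr ⟨(e, f), he⟩) ∧ y = Sum.inr (Sum.inl (f, e)))

/-- A `Z`-mixed cycle-factor of the mixed graph with undirected edge relation `E` and
arc relation `A`: a permutation `σ` that is the identity outside a vertex subset `W`
with `Z ⊆ W`, is fixed-point-free on `W`, moves every `v ∈ W` along an arc or an edge,
and never traverses a single undirected edge in both directions. -/
def IsZMixedCycleFactor {α : Type*} (E A : α → α → Prop) (Z W : Set α)
    (σ : Equiv.Perm α) : Prop :=
  Z ⊆ W ∧ (∀ v ∉ W, σ v = v) ∧ (∀ v ∈ W, σ v ≠ v) ∧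
  (∀ v ∈ W, A v (σ v) ∨ E v (σ v)) ∧
  (∀ v ∈ W, σ (σ v) = v → (A v (σ v) ∨ A (σ v) v))


/-- The `i`-th vertex of the path associated to the edge `k`, for `0 ≤ i ≤ m + 1`. -/
def pathVertex {V : Type*} {m : ℕ} (P : Set (Sym2 (Fin m))) (ends : Fin m → V × V)
    (k : Fin m) (i : ℕ) : GVert V m P :=
  if i = 0 then Sum.inl (ends k).1
  else if h : i - 1 < m then Sum.inr (Sum.inl (k, ⟨i - 1, h⟩))
  else Sum.inl (ends k).2

section

variable {V : Type*} {m : ℕ} {P : Set (Sym2 (Fin m))} {ends : Fin m → V × V}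

theorem pathVertex_succ {k : Fin m} {i : ℕ} (hi : i < m) :
    pathVertex P ends k (i + 1) = Sum.inr (Sum.inl (k, ⟨i, hi⟩)) := by
  simp [pathVertex, hi]

theorem eq_succ_of_pathVertex_eq {k k' l : Fin m} {i : ℕ}
    (h : pathVertex P ends k i = Sum.inr (Sum.inl (k', l))) : k = k' ∧ i = l + 1 := by
  unfold pathVertex at h
  split_ifs at h with h0 h1
  simp only [Sum.inr.injEq, Sum.inl.injEq, Prod.mk.injEq] at h
  obtain ⟨rfl, rfl⟩ := h
  exact ⟨rfl, by simp; omega⟩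

theorem pathVertex_ne_z {k : Fin m} {i : ℕ} (z : {p : Fin m × Fin m // s(p.1, p.2) ∈ P}) :
    pathVertex P ends k i ≠ Sum.inr (Sum.inr z) := by
  unfold pathVertex
  split_ifs <;> simp

theorem sEdge_iff {k : Fin m} {x y : GVert V m P} :
    SEdge P ends k x y ↔
      ∃ i ≤ m, x = pathVertex P ends k i ∧ y = pathVertex P ends k (i + 1) := by
  have hm : 0 < m := k.pos
  constructor
  · rintro (⟨rfl, rfl⟩ | ⟨l, l', h, rfl, rfl⟩ | ⟨rfl, rfl⟩)
    · exact ⟨0, by omega, by simp [pathVertex], by simp [pathVertex, hm]⟩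
    · refine ⟨l + 1, by omega, by simp [pathVertex], ?_⟩
      rw [pathVertex_succ (by omega)]
      simp [h]
    · exact ⟨m, le_rfl, by simp [pathVertex, hm.ne', hm], by simp [pathVertex]⟩
  · rintro ⟨i, hi, rfl, rfl⟩
    rcases i with _ | i
    · exact Or.inl ⟨by simp [pathVertex], by simp [pathVertex, hm]⟩
    · rcases hi.lt_or_eq with h | rfl
      · exact Or.inr (Or.inl ⟨⟨i, by omega⟩, ⟨i + 1, h⟩, rfl,
          pathVertex_succ _, pathVertex_succ _⟩)
      · exact Or.inr (Or.inr ⟨pathVertex_succ _, by simp [pathVertex]⟩)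

theorem GEdge.symm {x y : GVert V m P} (h : GEdge P ends x y) : GEdge P ends y x := by
  rcases h with ⟨k, h⟩ | ⟨e, f, he, hf, h⟩
  · exact Or.inl ⟨k, h.symm⟩
  · exact Or.inr ⟨e, f, he, hf, h.symm.imp And.symm And.symm⟩

theorem GEdge.eq_of_pathVertex {k : Fin m} {i : ℕ} (hi : i < m) {x : GVert V m P}
    (h : GEdge P ends x (pathVertex P ends k (i + 1))) :
    x = pathVertex P ends k i ∨ x = pathVertex P ends k (i + 2) := by
  rw [pathVertex_succ hi] at h
  rcases h with ⟨k', h | h⟩ | ⟨e, f, he, hf, ⟨-, h⟩ | ⟨-, h⟩⟩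
  · obtain ⟨j, -, rfl, hw⟩ := sEdge_iff.1 h
    obtain ⟨rfl, hj⟩ := eq_succ_of_pathVertex_eq hw.symm
    obtain rfl : j = i := by simpa using hj
    exact Or.inl rfl
  · obtain ⟨j, -, hw, rfl⟩ := sEdge_iff.1 h
    obtain ⟨rfl, rfl⟩ := eq_succ_of_pathVertex_eq hw.symm
    exact Or.inr rfl
  · simp at h
  · simp at h

theorem GEdge.z_eq {e f : Fin m} (he : s(e, f) ∈ P) (hf : s(f, e) ∈ P) {x : GVert V m P}
    (h : GEdge P ends (Sum.inr (Sum.inr ⟨(e, f), he⟩)) x) :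
    x = Sum.inr (Sum.inr ⟨(f, e), hf⟩) := by
  rcases h with ⟨k, h | h⟩ | ⟨e', f', he', hf', ⟨h, rfl⟩ | ⟨h, rfl⟩⟩
  · obtain ⟨j, -, h, -⟩ := sEdge_iff.1 h
    exact (pathVertex_ne_z _ h.symm).elim
  · obtain ⟨j, -, -, h⟩ := sEdge_iff.1 h
    exact (pathVertex_ne_z _ h.symm).elim
  all_goals
    simp only [Sum.inr.injEq, Subtype.mk.injEq, Prod.mk.injEq] at h
    obtain ⟨rfl, rfl⟩ := h
    rfl

theorem GArc.eq_of_z_left {e f : Fin m} {he : s(e, f) ∈ P} {x : GVert V m P}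
    (h : GArc P (Sum.inr (Sum.inr ⟨(e, f), he⟩)) x) : x = Sum.inr (Sum.inl (f, e)) := by
  obtain ⟨e', f', he', hf', h⟩ := h
  simp only [Sum.inr.injEq, Subtype.mk.injEq, Prod.mk.injEq, reduceCtorEq, false_and,
    false_or] at h
  rcases h with ⟨⟨rfl, rfl⟩, rfl⟩ | ⟨⟨rfl, rfl⟩, rfl⟩ <;> rfl

theorem GArc.eq_of_z_right {e f : Fin m} {he : s(e, f) ∈ P} {x : GVert V m P}
    (h : GArc P x (Sum.inr (Sum.inr ⟨(e, f), he⟩))) : x = Sum.inr (Sum.inl (e, f)) := by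
  obtain ⟨e', f', he', hf', h⟩ := h
  simp only [Sum.inr.injEq, Subtype.mk.injEq, Prod.mk.injEq, reduceCtorEq, and_false,
    false_or, or_false] at h
  rcases h with ⟨rfl, rfl, rfl⟩ | ⟨rfl, rfl, rfl⟩ <;> rfl

theorem GArc.w_left {e f : Fin m} {x : GVert V m P}
    (h : GArc P (Sum.inr (Sum.inl (e, f))) x) :
    ∃ (he : s(e, f) ∈ P), s(f, e) ∈ P ∧ x = Sum.inr (Sum.inr ⟨(e, f), he⟩) := by
  obtain ⟨e', f', he', hf', h⟩ := h
  simp only [Sum.inr.injEq, Sum.inl.injEq, Prod.mk.injEq, reduceCtorEq, false_and,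
    false_or, or_false] at h
  rcases h with ⟨⟨rfl, rfl⟩, rfl⟩ | ⟨⟨rfl, rfl⟩, rfl⟩
  · exact ⟨he', hf', rfl⟩
  · exact ⟨hf', he', rfl⟩

theorem GArc.w_right {e f : Fin m} {x : GVert V m P}
    (h : GArc P x (Sum.inr (Sum.inl (e, f)))) :
    ∃ (hf : s(f, e) ∈ P), s(e, f) ∈ P ∧ x = Sum.inr (Sum.inr ⟨(f, e), hf⟩) := by
  obtain ⟨e', f', he', hf', h⟩ := h
  simp only [Sum.inr.injEq, Sum.inl.injEq, Prod.mk.injEq, reduceCtorEq, and_false,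
    false_or] at h
  rcases h with ⟨rfl, rfl, rfl⟩ | ⟨rfl, rfl, rfl⟩
  · exact ⟨hf', he', rfl⟩
  · exact ⟨he', hf', rfl⟩

theorem not_gArc_pathVertex {k k' : Fin m} {i j : ℕ} :
    ¬ GArc P (pathVertex P ends k i) (pathVertex P ends k' j) := by
  rintro ⟨e, f, he, hf, ⟨-, h⟩ | ⟨h, -⟩ | ⟨-, h⟩ | ⟨h, -⟩⟩ <;> exact pathVertex_ne_z _ h

theorem IsZMixedCycleFactor.mem_of_ne {α : Type*} {E A : α → α → Prop} {Z W : Set α}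
    {σ : Equiv.Perm α} (h : IsZMixedCycleFactor E A Z W σ) {x : α} (hx : σ x ≠ x) : x ∈ W :=
  not_imp_comm.1 (h.2.1 x) hx

variable {W : Set (GVert V m P)} {σ : Equiv.Perm (GVert V m P)}

/-- A mixed cycle-factor that uses one of the two path edges at an inner path vertex `w`
uses the other one too. -/
theorem IsZMixedCycleFactor.used_of_used
    (hσ : IsZMixedCycleFactor (GEdge P ends) (GArc P)
      {x | ∃ p, x = Sum.inr (Sum.inr p)} W σ)
    {k : Fin m} {i a b : ℕ} (hi : i < m)
    (hnbr : ∀ x, GEdge P ends x (pathVertex P ends k (i + 1)) →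
      x = pathVertex P ends k a ∨ x = pathVertex P ends k b)
    (hne : pathVertex P ends k a ≠ pathVertex P ends k (i + 1))
    (hu : σ (pathVertex P ends k a) = pathVertex P ends k (i + 1) ∨
      σ (pathVertex P ends k (i + 1)) = pathVertex P ends k a) :
    σ (pathVertex P ends k b) = pathVertex P ends k (i + 1) ∨
      σ (pathVertex P ends k (i + 1)) = pathVertex P ends k b := by
  set w := pathVertex P ends k (i + 1) with hw
  set p := pathVertex P ends k a with hp
  have hwv : w = Sum.inr (Sum.inl (k, ⟨i, hi⟩)) := pathVertex_succ hi
  obtain ⟨hZ, -, -, hstep, hback⟩ := id hσ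
  have hback' : ¬ (σ p = w ∧ σ w = p) := by
    rintro ⟨h1, h2⟩
    have hpW : p ∈ W := hσ.mem_of_ne (by rw [h1]; exact hne.symm)
    have := hback p hpW (by rw [h1, h2])
    rw [h1] at this
    exact this.elim not_gArc_pathVertex not_gArc_pathVertex
  rcases hu with hu | hu
  · have hwW : w ∈ W := hσ.mem_of_ne fun h => hne (σ.injective (hu.trans h.symm))
    rcases hstep w hwW with h | h
    · rw [hwv] at h
      obtain ⟨he, hf, h⟩ := h.w_left
      rw [← hwv] at h
      rcases hstep _ (hZ ⟨⟨(⟨i, hi⟩, k), hf⟩, rfl⟩) with h' | h'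
      · have h' := h'.eq_of_z_left
        rw [← hwv, ← hu] at h'
        exact (pathVertex_ne_z _ (σ.injective h').symm).elim
      · have h' := h'.z_eq hf he
        rw [← h] at h'
        exact (pathVertex_ne_z _ (σ.injective h').symm).elim
    · rcases hnbr _ h.symm with h | h
      · exact (hback' ⟨hu, h⟩).elim
      · exact Or.inr h
  · obtain ⟨u, huw⟩ := σ.surjective w
    have huW : u ∈ W := hσ.mem_of_ne fun h => by
      have huw' : u = w := h.symm.trans huw
      subst huw'
      exact hne (hu.symm.trans h)
    rcases hstep u huW with h | h
    · rw [huw, hwv] at h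
      obtain ⟨hf, he, rfl⟩ := h.w_right
      obtain ⟨v, hv⟩ := σ.surjective (Sum.inr (Sum.inr ⟨(k, ⟨i, hi⟩), he⟩))
      have hvW : v ∈ W := by
        by_contra hvW
        have h' : σ v = v := hσ.2.1 v hvW
        exact hvW (hZ ⟨_, h'.symm.trans hv⟩)
      rcases hstep v hvW with h' | h'
      · rw [hv] at h'
        have h' := h'.eq_of_z_right
        rw [h', ← hwv, hu] at hv
        exact (pathVertex_ne_z _ hv).elim
      · rw [hv] at h'
        have h' := h'.symm.z_eq he hf
        rw [h', huw] at hv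
        exact (pathVertex_ne_z _ hv).elim
    · rw [huw] at h
      rcases hnbr _ h with rfl | rfl
      · exact (hback' ⟨huw, hu⟩).elim
      · exact Or.inl huw

theorem pathVertex_ne_succ (k : Fin m) {i : ℕ} (hi : i ≤ m) :
    pathVertex P ends k i ≠ pathVertex P ends k (i + 1) := by
  intro h
  rcases hi.lt_or_eq with hi | rfl
  · have := (eq_succ_of_pathVertex_eq (h.trans (pathVertex_succ hi))).2
    simp at this
  · obtain ⟨j, rfl⟩ := Nat.exists_eq_add_one.2 k.pos
    have := (eq_succ_of_pathVertex_eq (h.symm.trans (pathVertex_succ j.lt_succ_self))).2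
    simp at this

end

/-- If `σ` is a `Z`-mixed cycle-factor of `G` (with moved set `W`), then for every edge
`e` of `H`, either every edge of `S_e` is used by `σ` or no edge of `S_e` is used by
`σ`, where an undirected edge `{u, v}` of `G` is used by `σ` if `u, v ∈ W` and
`σ u = v` or `σ v = u`. -/
theorem steiner_mixed_cycle_factor_all_or_none_on_path
    {V : Type*} [Fintype V] [DecidableEq V] (m : ℕ)
    (ends : Fin m → V × V) (hloop : ∀ k, (ends k).1 ≠ (ends k).2)
    (hinj : Function.Injective fun k => s((ends k).1, (ends k).2))
    (P : Set (Sym2 (Fin m))) (hP : ∀ p ∈ P, ¬ p.IsDiag)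
    (W : Set (GVert V m P)) (σ : Equiv.Perm (GVert V m P))
    (hσ : IsZMixedCycleFactor (GEdge P ends) (GArc P)
      {x | ∃ p, x = Sum.inr (Sum.inr p)} W σ) :
    ∀ k : Fin m,
      (∀ x y, SEdge P ends k x y → (x ∈ W ∧ y ∈ W ∧ (σ x = y ∨ σ y = x))) ∨
      (∀ x y, SEdge P ends k x y → ¬(x ∈ W ∧ y ∈ W ∧ (σ x = y ∨ σ y = x))) := by
  intro k
  have hiff : ∀ i < m,
      ((σ (pathVertex P ends k i) = pathVertex P ends k (i + 1) ∨
        σ (pathVertex P ends k (i + 1)) = pathVertex P ends k i) ↔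
      (σ (pathVertex P ends k (i + 1)) = pathVertex P ends k (i + 2) ∨
        σ (pathVertex P ends k (i + 2)) = pathVertex P ends k (i + 1))) := fun i hi =>
    ⟨fun h => (hσ.used_of_used hi (fun _ hx => hx.eq_of_pathVertex hi)
        (pathVertex_ne_succ k hi.le) h).symm,
      fun h => hσ.used_of_used hi (fun _ hx => (hx.eq_of_pathVertex hi).symm)
        (pathVertex_ne_succ k hi).symm h.symm⟩
  have hzero : ∀ i ≤ m,
      ((σ (pathVertex P ends k i) = pathVertex P ends k (i + 1) ∨
        σ (pathVertex P ends k (i + 1)) = pathVertex P ends k i) ↔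
      (σ (pathVertex P ends k 0) = pathVertex P ends k 1 ∨
        σ (pathVertex P ends k 1) = pathVertex P ends k 0)) := by
    intro i hi
    induction i with
    | zero => rfl
    | succ i ih => exact (hiff i hi).symm.trans (ih (by omega))
  have hmem : ∀ x y, x ≠ y → σ x = y → x ∈ W ∧ y ∈ W := fun x y hxy h =>
    ⟨hσ.mem_of_ne (by rw [h]; exact hxy.symm),
      hσ.mem_of_ne fun h' => hxy (σ.injective (h.trans h'.symm))⟩
  by_cases h0 : σ (pathVertex P ends k 0) = pathVertex P ends k 1 ∨
      σ (pathVertex P ends k 1) = pathVertex P ends k 0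
  · left
    intro x y hxy
    obtain ⟨i, hi, rfl, rfl⟩ := sEdge_iff.1 hxy
    have hu := (hzero i hi).2 h0
    rcases hu with h | h
    · obtain ⟨h1, h2⟩ := hmem _ _ (pathVertex_ne_succ k hi) h
      exact ⟨h1, h2, Or.inl h⟩
    · obtain ⟨h1, h2⟩ := hmem _ _ (pathVertex_ne_succ k hi).symm h
      exact ⟨h2, h1, Or.inr h⟩
  · right
    rintro x y hxy ⟨-, -, hu⟩
    obtain ⟨i, hi, rfl, rfl⟩ := sEdge_iff.1 hxy
    exact h0 ((hzero i hi).1 hu)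
end

section
/- Let H be a finite mixed graph and Z ⊆ V(H). Let G be the mixed graph obtained from H by adding, for every vertex v ∈ V(H) \ Z, three new vertices u1_v, u2_v, u3_v and the five undirected edges {v, u1_v}, {u1_v, u2_v}, {u2_v, u3_v}, {u3_v, u1_v}, {u3_v, v}. Then H has a Z-mixed cycle-factor if and only if G has a mixed cycle-factor (i.e., a V(G)-mixed cycle-factor). -/
/-- Vertices of the mixed graph `G` obtained from a mixed graph `H` and a set
`Z ⊆ V(H)` by adding, for every vertex `v ∉ Z`, three new vertices
`u1_v = (v, 0)`, `u2_v = (v, 1)`, `u3_v = (v, 2)`. -/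
abbrev MVert (V : Type*) (Z : Set V) : Type _ := V ⊕ ({v : V // v ∉ Z} × Fin 3)

/-- Undirected edges of `G`: the edges of `H`, together with, for every `v ∉ Z`, the
five edges `{v, u1_v}`, `{u1_v, u2_v}`, `{u2_v, u3_v}`, `{u3_v, u1_v}`, `{u3_v, v}`
(symmetrized). -/
def MEdge {V : Type*} (EdgeH : V → V → Prop) (Z : Set V) :
    MVert V Z → MVert V Z → Prop := fun x y =>
  (∃ a b, EdgeH a b ∧ x = Sum.inl a ∧ y = Sum.inl b) ∨
  (∃ p : {v : V // v ∉ Z},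
    (x = Sum.inl p.1 ∧ y = Sum.inr (p, 0)) ∨ (x = Sum.inr (p, 0) ∧ y = Sum.inl p.1) ∨
    (x = Sum.inr (p, 0) ∧ y = Sum.inr (p, 1)) ∨ (x = Sum.inr (p, 1) ∧ y = Sum.inr (p, 0)) ∨
    (x = Sum.inr (p, 1) ∧ y = Sum.inr (p, 2)) ∨ (x = Sum.inr (p, 2) ∧ y = Sum.inr (p, 1)) ∨
    (x = Sum.inr (p, 2) ∧ y = Sum.inr (p, 0)) ∨ (x = Sum.inr (p, 0) ∧ y = Sum.inr (p, 2)) ∨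
    (x = Sum.inr (p, 2) ∧ y = Sum.inl p.1) ∨ (x = Sum.inl p.1 ∧ y = Sum.inr (p, 2)))

/-- Arcs of `G`: exactly the arcs of `H`. -/
def MArc {V : Type*} (ArcH : V → V → Prop) (Z : Set V) :
    MVert V Z → MVert V Z → Prop := fun x y =>
  ∃ a b, ArcH a b ∧ x = Sum.inl a ∧ y = Sum.inl b

lemma mEdge_inl_inl {V : Type*} {E : V → V → Prop} {Z : Set V} {a b : V} :
    MEdge E Z (Sum.inl a) (Sum.inl b) ↔ E a b := by
  simp [MEdge]

lemma mEdge_inl_inr {V : Type*} {E : V → V → Prop} {Z : Set V} {a : V}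
    {p : {v : V // v ∉ Z}} {i : Fin 3} :
    MEdge E Z (Sum.inl a) (Sum.inr (p, i)) ↔ p.1 = a ∧ i ≠ 1 := by
  constructor
  · simp only [MEdge]
    rintro (⟨a, b, h, h1, h2⟩ | ⟨q, h⟩)
    · simp at h2
    · simp only [Sum.inl.injEq, Sum.inr.injEq, Prod.mk.injEq, reduceCtorEq, false_and, and_false,
        false_or] at h
      rcases h with ⟨rfl, rfl, rfl⟩ | ⟨rfl, rfl, rfl⟩ <;> simp
  · rintro ⟨rfl, hi⟩
    refine Or.inr ⟨p, ?_⟩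
    fin_cases i <;> simp_all

lemma mEdge_inr_inl {V : Type*} {E : V → V → Prop} {Z : Set V} {a : V}
    {p : {v : V // v ∉ Z}} {i : Fin 3} :
    MEdge E Z (Sum.inr (p, i)) (Sum.inl a) ↔ p.1 = a ∧ i ≠ 1 := by
  constructor
  · simp only [MEdge]
    rintro (⟨a, b, h, h1, h2⟩ | ⟨q, h⟩)
    · simp at h1
    · simp only [Sum.inl.injEq, Sum.inr.injEq, Prod.mk.injEq, reduceCtorEq, and_false,
        or_false, false_or] at h
      rcases h with ⟨⟨rfl, rfl⟩, rfl⟩ | ⟨⟨rfl, rfl⟩, rfl⟩ <;> simp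
  · rintro ⟨rfl, hi⟩
    refine Or.inr ⟨p, ?_⟩
    fin_cases i <;> simp_all

lemma mEdge_inr_inr {V : Type*} {E : V → V → Prop} {Z : Set V}
    {p q : {v : V // v ∉ Z}} {i j : Fin 3} :
    MEdge E Z (Sum.inr (p, i)) (Sum.inr (q, j)) ↔ p = q ∧ i ≠ j := by
  constructor
  · simp only [MEdge]
    rintro (⟨a, b, h, h1, h2⟩ | ⟨r, h⟩)
    · simp at h1
    · simp only [Sum.inr.injEq, Prod.mk.injEq, reduceCtorEq, false_and, and_false,
        or_false, false_or] at h
      rcases h with ⟨⟨rfl, rfl⟩, rfl, rfl⟩ | ⟨⟨rfl, rfl⟩, rfl, rfl⟩ | ⟨⟨rfl, rfl⟩, rfl, rfl⟩ |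
        ⟨⟨rfl, rfl⟩, rfl, rfl⟩ | ⟨⟨rfl, rfl⟩, rfl, rfl⟩ | ⟨⟨rfl, rfl⟩, rfl, rfl⟩ <;> simp
  · rintro ⟨rfl, hij⟩
    refine Or.inr ⟨p, ?_⟩
    fin_cases i <;> fin_cases j <;> simp_all

lemma mArc_inl_inl {V : Type*} {A : V → V → Prop} {Z : Set V} {a b : V} :
    MArc A Z (Sum.inl a) (Sum.inl b) ↔ A a b := by
  simp [MArc]

lemma not_mArc_inr_left {V : Type*} {A : V → V → Prop} {Z : Set V}
    {u : {v : V // v ∉ Z} × Fin 3} {x : MVert V Z} : ¬ MArc A Z (Sum.inr u) x := by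
  simp [MArc]

lemma not_mArc_inr_right {V : Type*} {A : V → V → Prop} {Z : Set V}
    {u : {v : V // v ∉ Z} × Fin 3} {x : MVert V Z} : ¬ MArc A Z x (Sum.inr u) := by
  simp [MArc]

/-- A cycle of a mixed cycle-factor of `G` that enters a vertex of `H` from a vertex of `H`
also leaves it towards a vertex of `H`. -/
lemma exists_inl_of_apply_inl_eq_inl {V : Type*} {E A : V → V → Prop} {Z : Set V}
    {σ : Equiv.Perm (MVert V Z)}
    (hσ : IsZMixedCycleFactor (MEdge E Z) (MArc A Z) Set.univ Set.univ σ)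
    {u v : V} (huv : σ (Sum.inl u) = Sum.inl v) : ∃ w, σ (Sum.inl v) = Sum.inl w := by
  obtain ⟨-, -, -, hadj, -⟩ := hσ
  rcases hv : σ (Sum.inl v) with w | ⟨p, i⟩
  · exact ⟨w, rfl⟩
  exfalso
  have hinj : ∀ {x y z}, σ x = z → σ y = z → x = y := fun hx hy => σ.injective (hx.trans hy.symm)
  have h := (hadj (Sum.inl v) trivial)
  rw [hv] at h
  obtain ⟨rfl, -⟩ := mEdge_inl_inr.1 (h.resolve_left not_mArc_inr_right)
  -- no vertex of the gadget can step out of it or to its entry `i`, as both targets are taken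
  have next : ∀ k, ∃ j, σ (Sum.inr (p, k)) = Sum.inr (p, j) ∧ j ≠ i := by
    intro k
    have h := (hadj (Sum.inr (p, k)) trivial).resolve_left not_mArc_inr_left
    rcases hk : σ (Sum.inr (p, k)) with a | ⟨q, j⟩
    · rw [hk, mEdge_inr_inl] at h
      exact absurd (hinj huv (h.1 ▸ hk)) Sum.inl_ne_inr
    · rw [hk, mEdge_inr_inr] at h
      obtain ⟨rfl, -⟩ := h
      refine ⟨j, rfl, ?_⟩
      rintro rfl
      exact Sum.inl_ne_inr (hinj hv hk)
  choose f hf hfi using next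
  have hfinj : Function.Injective f := fun a b hab => by
    simpa using hinj (hf a) ((hf b).trans (by rw [hab]))
  obtain ⟨k, hk⟩ := Finite.surjective_of_injective hfinj i
  exact hfi k hk

open Classical in
/-- Extension of a `Z`-cycle-factor of `H` to `G`: a gadget is traversed as a triangle if its
vertex is covered, and as a 4-cycle through its vertex otherwise. -/
noncomputable def gadgetExtension {V : Type*} (Z W : Set V) (hZW : Z ⊆ W) (f : V → V) :
    MVert V Z → MVert V Z
  | Sum.inl v => if h : v ∈ W then Sum.inl (f v) else Sum.inr (⟨v, fun hz => h (hZW hz)⟩, 0)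
  | Sum.inr (p, 0) => Sum.inr (p, 1)
  | Sum.inr (p, 1) => Sum.inr (p, 2)
  | Sum.inr (p, 2) => if p.1 ∈ W then Sum.inr (p, 0) else Sum.inl p.1

lemma gadgetExtension_injective {V : Type*} {Z W : Set V} (hZW : Z ⊆ W) {f : V → V}
    (hf : Function.Injective f) (hW : ∀ v ∈ W, f v ∈ W) :
    Function.Injective (gadgetExtension Z W hZW f) := by
  rintro (a | ⟨⟨p, hp⟩, i⟩) (b | ⟨⟨q, hq⟩, j⟩) h
  · by_cases ha : a ∈ W <;> by_cases hb : b ∈ W <;> simp_all [gadgetExtension, hf.eq_iff]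
  · by_cases ha : a ∈ W <;> by_cases hb : q ∈ W <;> fin_cases j <;>
      simp_all [gadgetExtension]
    grind
  · by_cases ha : b ∈ W <;> by_cases hb : p ∈ W <;> fin_cases i <;>
      simp_all [gadgetExtension]
  · by_cases ha : p ∈ W <;> by_cases hb : q ∈ W <;> fin_cases i <;> fin_cases j <;>
      simp_all [gadgetExtension]

lemma IsZMixedCycleFactor.mapsTo {α : Type*} {E A : α → α → Prop} {Z W : Set α}
    {σ : Equiv.Perm α} (hσ : IsZMixedCycleFactor E A Z W σ) : ∀ v ∈ W, σ v ∈ W := by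
  intro v hv
  by_contra h
  exact hσ.2.2.1 v hv (σ.injective (hσ.2.1 _ h))

lemma exists_mixedCycleFactor_of_isZMixedCycleFactor {V : Type*} [Finite V]
    {E A : V → V → Prop} {Z W : Set V} {σ : Equiv.Perm V} (hσ : IsZMixedCycleFactor E A Z W σ) :
    ∃ τ : Equiv.Perm (MVert V Z),
      IsZMixedCycleFactor (MEdge E Z) (MArc A Z) Set.univ Set.univ τ := by
  have hW := hσ.mapsTo
  obtain ⟨hZW, -, hne, hadj, hback⟩ := hσ
  refine ⟨Equiv.ofBijective (gadgetExtension Z W hZW σ)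
    (Finite.injective_iff_bijective.1 (gadgetExtension_injective hZW σ.injective hW)),
    subset_rfl, by simp, ?_, ?_, ?_⟩
  · rintro (v | ⟨⟨p, hp⟩, i⟩) -
    · by_cases hv : v ∈ W <;> simp [gadgetExtension, hv]
      exact hne v hv
    · by_cases hv : p ∈ W <;> fin_cases i <;> simp [gadgetExtension, hv]
  · rintro (v | ⟨⟨p, hp⟩, i⟩) -
    · by_cases hv : v ∈ W
      · simpa [gadgetExtension, hv, mArc_inl_inl, mEdge_inl_inl] using hadj v hv
      · simp [gadgetExtension, hv, mEdge_inl_inr]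
    · by_cases hv : p ∈ W <;> fin_cases i <;>
        simp [gadgetExtension, hv, mEdge_inr_inr, mEdge_inr_inl]
  · rintro (v | ⟨⟨p, hp⟩, i⟩) -
    · by_cases hv : v ∈ W
      · simpa [gadgetExtension, hv, hW v hv, mArc_inl_inl] using hback v hv
      · simp [gadgetExtension, hv]
    · by_cases hv : p ∈ W <;> fin_cases i <;> simp [gadgetExtension, hv]

lemma exists_isZMixedCycleFactor_of_mixedCycleFactor {V : Type*} [Finite V]
    {E A : V → V → Prop} {Z : Set V} {τ : Equiv.Perm (MVert V Z)}
    (hτ : IsZMixedCycleFactor (MEdge E Z) (MArc A Z) Set.univ Set.univ τ) :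
    ∃ (W : Set V) (σ : Equiv.Perm V), IsZMixedCycleFactor E A Z W σ := by
  have hmaps := fun {u v} => exists_inl_of_apply_inl_eq_inl hτ (u := u) (v := v)
  obtain ⟨-, -, hne, hadj, hback⟩ := hτ
  let f : V → V := fun v => Sum.elim id (fun _ => v) (τ (Sum.inl v))
  have hf : ∀ {v w}, τ (Sum.inl v) = Sum.inl w → f v = w := fun h => by simp [f, h]
  have hf' : ∀ {v u}, τ (Sum.inl v) = Sum.inr u → f v = v := fun h => by simp [f, h]
  have hinj : Function.Injective f := by
    intro a b hab
    rcases ha : τ (Sum.inl a) with a' | u <;> rcases hb : τ (Sum.inl b) with b' | w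
    · rw [hf ha, hf hb] at hab
      exact Sum.inl_injective (τ.injective (by rw [ha, hb, hab]))
    · rw [hf ha, hf' hb] at hab
      obtain ⟨c, hc⟩ := hmaps ha
      simp [hab, hb] at hc
    · rw [hf' ha, hf hb] at hab
      obtain ⟨c, hc⟩ := hmaps hb
      simp [← hab, ha] at hc
    · rwa [hf' ha, hf' hb] at hab
  refine ⟨{v | ∃ w, τ (Sum.inl v) = Sum.inl w},
    Equiv.ofBijective f (Finite.injective_iff_bijective.1 hinj), ?_, ?_, ?_, ?_, ?_⟩
  · intro v hv
    rcases h : τ (Sum.inl v) with w | ⟨p, i⟩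
    · exact ⟨w, h⟩
    · have := (hadj (Sum.inl v) trivial)
      rw [h] at this
      exact absurd ((mEdge_inl_inr.1 (this.resolve_left not_mArc_inr_right)).1 ▸ hv) p.2
  · intro v hv
    rcases h : τ (Sum.inl v) with w | u
    · exact absurd ⟨w, h⟩ hv
    · exact hf' h
  · rintro v ⟨w, h⟩ hv
    have hv : f v = v := hv
    rw [hf h] at hv
    exact hne (Sum.inl v) trivial (by rw [h, hv])
  · rintro v ⟨w, h⟩
    have := hadj (Sum.inl v) trivial
    rw [h, mArc_inl_inl, mEdge_inl_inl] at this
    simpa [hf h] using this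
  · rintro v ⟨w, h⟩ hv
    obtain ⟨c, hc⟩ := hmaps h
    have hv : f (f v) = v := hv
    rw [hf h, hf hc] at hv
    have := hback (Sum.inl v) trivial (by rw [h, hc, hv])
    rw [h, mArc_inl_inl, mArc_inl_inl] at this
    simpa [hf h] using this

/-- `H` has a `Z`-mixed cycle-factor iff `G` has a mixed cycle-factor
(i.e. a `V(G)`-mixed cycle-factor). -/
theorem steiner_mixed_cycle_factor_iff_mixed_cycle_factor
    {V : Type*} [Fintype V] (EdgeH ArcH : V → V → Prop)
    (hEsymm : Symmetric EdgeH) (hEirr : Irreflexive EdgeH)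
    (hAirr : Irreflexive ArcH) (Z : Set V) :
    (∃ (W : Set V) (σ : Equiv.Perm V), IsZMixedCycleFactor EdgeH ArcH Z W σ) ↔
    (∃ σ : Equiv.Perm (MVert V Z),
        IsZMixedCycleFactor (MEdge EdgeH Z) (MArc ArcH Z) Set.univ Set.univ σ) := by
  exact ⟨fun ⟨_, _, hσ⟩ => exists_mixedCycleFactor_of_isZMixedCycleFactor hσ,
    fun ⟨_, hτ⟩ => exists_isZMixedCycleFactor_of_mixedCycleFactor hτ⟩
end

section
/- Let H be a finite mixed graph and Z ⊆ V(H), and let G be the mixed graph obtained from H by adding, for every vertex v ∈ V(H) \ Z, three new vertices u1_v, u2_v, u3_v and the five undirected edges {v, u1_v}, {u1_v, u2_v}, {u2_v, u3_v}, {u3_v, u1_v}, {u3_v, v}. Let σ be a mixed cycle-factor of G. Then every cycle (orbit) of σ is either contained in V(H) or contained in {v, u1_v, u2_v, u3_v} for some v ∈ V(H) \ Z. -/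
/-- A set mapped into itself by a permutation of a finite type is closed under `SameCycle`. -/
theorem Equiv.Perm.SameCycle.mem_of_mapsTo {α : Type*} [Finite α] {σ : Equiv.Perm α}
    {S : Set α} (hS : Set.MapsTo σ S S) {x y : α} (h : σ.SameCycle x y) (hx : x ∈ S) :
    y ∈ S := by
  obtain ⟨n, -, rfl⟩ := h.exists_pow_eq'
  rw [← Equiv.Perm.iterate_eq_pow]
  exact hS.iterate n hx

/-- The vertex set `{v, u1_v, u2_v, u3_v}` of the gadget attached at `v ∉ Z`. -/
def gadget {V : Type*} {Z : Set V} (p : {v : V // v ∉ Z}) : Set (MVert V Z) :=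
  {y | y = Sum.inl p.1 ∨ ∃ i : Fin 3, y = Sum.inr (p, i)}

theorem mem_gadget_of_inr_step {V : Type*} {EdgeH ArcH : V → V → Prop} {Z : Set V}
    {p : {v : V // v ∉ Z}} {i : Fin 3} {y : MVert V Z}
    (h : MArc ArcH Z (Sum.inr (p, i)) y ∨ MEdge EdgeH Z (Sum.inr (p, i)) y) :
    y ∈ gadget p := by
  simp only [gadget, Set.mem_ofPred_eq]
  rcases h with ⟨a, b, -, h, -⟩ | ⟨a, b, -, h, -⟩ | ⟨q, h⟩
  · cases h
  · cases h
  · rcases h with h | h | h | h | h | h | h | h | h | h <;> obtain ⟨h, rfl⟩ := h <;> cases h <;>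
      simp

theorem mem_gadget_of_step_inr {V : Type*} {EdgeH ArcH : V → V → Prop} {Z : Set V}
    {p : {v : V // v ∉ Z}} {i : Fin 3} {x : MVert V Z}
    (h : MArc ArcH Z x (Sum.inr (p, i)) ∨ MEdge EdgeH Z x (Sum.inr (p, i))) :
    x ∈ gadget p := by
  simp only [gadget, Set.mem_ofPred_eq]
  rcases h with ⟨a, b, -, -, h⟩ | ⟨a, b, -, -, h⟩ | ⟨q, h⟩
  · cases h
  · cases h
  · rcases h with h | h | h | h | h | h | h | h | h | h <;> obtain ⟨rfl, h⟩ := h <;> cases h <;>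
      simp

/-- If `σ` is a mixed cycle-factor of `G`, then every cycle (orbit) of `σ` is either
contained in `V(H)` or contained in `{v, u1_v, u2_v, u3_v}` for some vertex
`v ∈ V(H) \ Z`. -/
theorem mixed_cycle_factor_orbit_localization
    {V : Type*} [Fintype V] (EdgeH ArcH : V → V → Prop)
    (hEsymm : Symmetric EdgeH) (hEirr : Irreflexive EdgeH)
    (hAirr : Irreflexive ArcH) (Z : Set V)
    (σ : Equiv.Perm (MVert V Z))
    (hσ : IsZMixedCycleFactor (MEdge EdgeH Z) (MArc ArcH Z) Set.univ Set.univ σ) :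
    ∀ x : MVert V Z,
      (∀ y, σ.SameCycle x y → ∃ a : V, y = Sum.inl a) ∨
      (∃ p : {v : V // v ∉ Z}, ∀ y, σ.SameCycle x y →
        y = Sum.inl p.1 ∨ ∃ i : Fin 3, y = Sum.inr (p, i)) := by
  obtain ⟨-, -, -, hstep, -⟩ := hσ
  intro x
  by_cases hx : ∀ y, σ.SameCycle x y → ∃ a : V, y = Sum.inl a
  · exact Or.inl hx
  right
  push Not at hx
  obtain ⟨a | ⟨p, i⟩, hxy, hy⟩ := hx
  · exact absurd rfl (hy a)
  refine ⟨p, fun z hxz => ?_⟩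
  have hcycle : σ.SameCycle (Sum.inr (p, i)) z := hxy.symm.trans hxz
  by_cases hp : ∃ j, σ (Sum.inl p.1) = Sum.inr (p, j)
  · have hS : Set.MapsTo σ (gadget p) (gadget p) := by
      rintro w (rfl | ⟨j, rfl⟩)
      · exact Or.inr hp
      · exact mem_gadget_of_inr_step (hstep _ (Set.mem_univ _))
    exact hcycle.mem_of_mapsTo hS (Or.inr ⟨i, rfl⟩)
  · have hS : Set.MapsTo σ {w | ¬ ∃ j, w = Sum.inr (p, j)} {w | ¬ ∃ j, w = Sum.inr (p, j)} := by
      rintro w hw ⟨j, hj⟩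
      have hstep_w := hstep w (Set.mem_univ _)
      rw [hj] at hstep_w
      rcases mem_gadget_of_step_inr hstep_w with rfl | hw'
      · exact hp ⟨j, hj⟩
      · exact hw hw'
    by_contra hz
    exact hcycle.symm.mem_of_mapsTo hS (fun h => hz (Or.inr h)) ⟨i, rfl⟩
end
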